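/- Let f be an E-function transcendental over ℂ(z) satisfying a first-order (possibly inhomogeneous) differential equation a(z) f'(z) = b(z) f(z) + c(z) identically, where a, b, c ∈ ℚ̄[z], a is not identically zero, and a, b, c have no common nonconstant polynomial factor. Then for every nonzero algebraic number α: f(α) is algebraic if and only if a(α) = 0; moreover, if a(α) = 0 then f(α) = −c(α)/b(α), and in the homogeneous case c ≡ 0 one has f(α) = 0 at every nonzero algebraic α with a(α) = 0. -/

import Mathlib

noncomputable section

/-- `ℚ̄`: the field of algebraic numbers, i.e. the algebraic closure of `ℚ` inside `ℂ`. -/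
def Qbar : IntermediateField ℚ ℂ := algebraicClosure ℚ ℂ

/-- `f : ℂ → ℂ` is the E-function with Taylor coefficients `aₙ/n!` (the `aₙ` being
algebraic numbers): `f(z) = ∑ aₙ/n! zⁿ`; the conjugates of the `aₙ` grow at most
geometrically; the `aₙ` admit denominators growing at most geometrically; and `f`
satisfies a nonzero linear differential equation with coefficients in `ℚ̄(z)`
(equivalently, after clearing denominators, with polynomial coefficients all of
whose coefficients are algebraic). -/
def IsEFunctionWith (a : ℕ → Qbar) (f : ℂ → ℂ) : Prop :=
  (∀ z : ℂ, HasSum (fun n : ℕ => (a n : ℂ) / n.factorial * z ^ n) (f z)) ∧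
  (∃ C : ℝ, 0 < C ∧ ∀ σ : Qbar →+* ℂ, ∀ n : ℕ, ‖σ (a n)‖ ≤ C ^ (n + 1)) ∧
  (∃ D : ℝ, 0 < D ∧ ∃ d : ℕ → ℕ, (∀ n : ℕ, d n ≠ 0 ∧ (d n : ℝ) ≤ D ^ (n + 1)) ∧
    ∀ n : ℕ, ∀ m ≤ n, IsIntegral ℤ ((d n : ℂ) * (a m : ℂ))) ∧
  (∃ r : ℕ, ∃ p : Fin (r + 1) → Polynomial ℂ,
    (∀ j, ∀ i, IsAlgebraic ℚ ((p j).coeff i)) ∧ (∃ j, p j ≠ 0) ∧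
    ∀ z : ℂ, ∑ j : Fin (r + 1), (p j).eval z * iteratedDeriv (j : ℕ) f z = 0)

/-- `f : ℂ → ℂ` is an E-function. -/
def IsEFunction (f : ℂ → ℂ) : Prop := ∃ a : ℕ → Qbar, IsEFunctionWith a f

/-- The function `f` is algebraic over `ℂ(z)`: there is a nonzero two-variable
polynomial `P ∈ ℂ[z][Y]` with `P(z, f(z)) = 0` for all `z`. -/
def IsAlgebraicFunc (f : ℂ → ℂ) : Prop :=
  ∃ P : Polynomial (Polynomial ℂ), P ≠ 0 ∧
    ∀ z : ℂ, ((P.eval (Polynomial.C (f z))).eval z) = 0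

open Polynomial

section FormalDerivation

variable {A : Type*} [CommRing A]

/-- The derivation `a ∂/∂z + (b y + c) ∂/∂y` of `A[z][y]`, a polynomial in `y` being represented
by its sequence of coefficients. -/
def odeDerivation (a b c : A[X]) (q : ℕ → A[X]) : ℕ → A[X] :=
  fun i => a * derivative (q i) + i * b * q i + (i + 1) * c * q (i + 1)

variable (a b c : A[X])

lemma odeDerivation_add (p q : ℕ → A[X]) :
    odeDerivation a b c (p + q) = odeDerivation a b c p + odeDerivation a b c q := by
  funext i
  simp only [odeDerivation, Pi.add_apply, derivative_add]
  ring

lemma odeDerivation_zero : odeDerivation a b c 0 = 0 := by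
  funext i
  simp [odeDerivation]

lemma odeDerivation_smul (r : A[X]) (q : ℕ → A[X]) :
    odeDerivation a b c (r • q) = (a * derivative r) • q + r • odeDerivation a b c q := by
  funext i
  simp only [odeDerivation, Pi.add_apply, Pi.smul_apply, smul_eq_mul, derivative_mul]
  ring

lemma odeDerivation_iterate_eq_zero {N : ℕ} {q : ℕ → A[X]} (hq : ∀ i > N, q i = 0) (k : ℕ) :
    ∀ i > N, ((odeDerivation a b c)^[k] q) i = 0 := by
  induction k with
  | zero => simpa using hq
  | succ k ih =>
    intro i hi
    rw [Function.iterate_succ_apply', odeDerivation, ih i hi, ih (i + 1) (by omega)]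
    simp

lemma odeDerivation_iterate_map {B : Type*} [CommRing B] (φ : A →+* B) (q : ℕ → A[X]) (k : ℕ) :
    (odeDerivation (a.map φ) (b.map φ) (c.map φ))^[k] (fun i => (q i).map φ) =
      fun i => (((odeDerivation a b c)^[k] q) i).map φ := by
  induction k with
  | zero => rfl
  | succ k ih =>
    rw [Function.iterate_succ_apply', ih, Function.iterate_succ_apply']
    funext i
    simp [odeDerivation, derivative_map]

end FormalDerivation

section ZeroEstimateAlgebra

/-- The elements having a nonzero multiple in `W`. -/
def saturation {R M : Type*} [CommRing R] [IsDomain R] [AddCommGroup M] [Module R M]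
    (W : Submodule R M) : Submodule R M where
  carrier := {x | ∃ r : R, r ≠ 0 ∧ r • x ∈ W}
  zero_mem' := ⟨1, one_ne_zero, by simp⟩
  add_mem' := by
    rintro x y ⟨r, hr, hx⟩ ⟨s, hs, hy⟩
    refine ⟨r * s, mul_ne_zero hr hs, ?_⟩
    rw [smul_add, mul_comm r s, mul_smul, mul_comm s r, mul_smul]
    exact W.add_mem (W.smul_mem _ hx) (W.smul_mem _ hy)
  smul_mem' := by
    rintro t x ⟨r, hr, hx⟩
    exact ⟨r, hr, by rw [smul_comm]; exact W.smul_mem _ hx⟩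

lemma mem_saturation_of_smul_mem {R M : Type*} [CommRing R] [IsDomain R] [AddCommGroup M]
    [Module R M] {W : Submodule R M} {r : R} (hr : r ≠ 0) {x : M}
    (hx : r • x ∈ saturation W) : x ∈ saturation W := by
  obtain ⟨s, hs, h⟩ := hx
  exact ⟨s * r, mul_ne_zero hs hr, by rwa [mul_smul]⟩

lemma le_saturation {R M : Type*} [CommRing R] [IsDomain R] [AddCommGroup M]
    [Module R M] (W : Submodule R M) : W ≤ saturation W :=
  fun x hx => ⟨1, one_ne_zero, by simpa using hx⟩

variable {F : Type*} [Field F] {a b c : F[X]}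

lemma eq_sum_smul_single {P : ℕ → F[X]} {S : Finset ℕ} (hP : ∀ i ∉ S, P i = 0) :
    P = ∑ d ∈ S, P d • (Pi.single d 1 : ℕ → F[X]) := by
  funext i
  rw [Finset.sum_apply]
  simp only [Pi.smul_apply, smul_eq_mul, Pi.single_apply, mul_ite, mul_one, mul_zero]
  by_cases hi : i ∈ S <;> simp [hi, hP]

lemma single_mem_of_forall_single_mem {V : Submodule F[X] (ℕ → F[X])}
    (hsat : ∀ (r : F[X]) (Q : ℕ → F[X]), r ≠ 0 → r • Q ∈ V → Q ∈ V)
    {P : ℕ → F[X]} (hPV : P ∈ V) {S : Finset ℕ} {e : ℕ} (he : e ∉ S) (hPe : P e ≠ 0)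
    (hP : ∀ i ∉ insert e S, P i = 0) (hS : ∀ d ∈ S, (Pi.single d 1 : ℕ → F[X]) ∈ V) :
    (Pi.single e 1 : ℕ → F[X]) ∈ V := by
  refine hsat _ _ hPe ?_
  have h := eq_sum_smul_single hP
  rw [Finset.sum_insert he] at h
  rw [← sub_eq_iff_eq_add.mpr h]
  exact V.sub_mem hPV (V.sum_mem fun d hd => V.smul_mem _ (hS d hd))

/-- If `y' = (b y + c) / a` has no rational solution, then a saturated submodule that is stable
under the derivation and contains a polynomial of degree `r` in `y` contains `1, y, …, y ^ r`. -/
lemma single_mem_of_no_rational_solution [CharZero F]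
    (hno : ∀ p g : F[X], p ≠ 0 →
      p * (a * derivative g) - g * (a * derivative p) ≠ b * g * p + c * p ^ 2)
    {V : Submodule F[X] (ℕ → F[X])}
    (hsat : ∀ (r : F[X]) (Q : ℕ → F[X]), r ≠ 0 → r • Q ∈ V → Q ∈ V)
    (hD : ∀ Q ∈ V, odeDerivation a b c Q ∈ V) (r : ℕ) :
    ∀ P ∈ V, P r ≠ 0 → (∀ i > r, P i = 0) →
      ∀ d ∈ Finset.range (r + 1), (Pi.single d 1 : ℕ → F[X]) ∈ V := by
  induction r with
  | zero =>
    intro P hPV hPr hP d hd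
    obtain rfl : d = 0 := by simpa using hd
    exact single_mem_of_forall_single_mem hsat hPV (S := ∅) (by simp) hPr
      (fun i hi => hP i (by simp at hi; omega)) (by simp)
  | succ r ih =>
    intro P hPV hPr hP
    set p := P (r + 1) with hp
    have hlow : ∀ d ∈ Finset.range (r + 1), (Pi.single d 1 : ℕ → F[X]) ∈ V := by
      refine ih (p • odeDerivation a b c P -
        (a * derivative p + ((r + 1 : ℕ) : F[X]) * b * p) • P) ?_ ?_ ?_
      · exact V.sub_mem (V.smul_mem _ (hD _ hPV)) (V.smul_mem _ hPV)
      · intro h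
        have hr : ((r + 1 : ℕ) : F[X]) ≠ 0 := by exact_mod_cast r.succ_ne_zero
        refine hno (((r + 1 : ℕ) : F[X]) * p) (-P r) (mul_ne_zero hr hPr) ?_
        simp only [Pi.sub_apply, Pi.smul_apply, smul_eq_mul, odeDerivation, ← hp] at h
        rw [derivative_mul, derivative_natCast, derivative_neg]
        push_cast at h ⊢
        linear_combination (-(r + 1 : F[X])) * h
      · intro i hi
        simp only [Pi.sub_apply, Pi.smul_apply, smul_eq_mul, odeDerivation]
        rcases Nat.lt_or_ge (r + 1) i with h | h
        · rw [hP i h, hP (i + 1) (by omega)]; simp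
        · obtain rfl : i = r + 1 := by omega
          rw [hP (r + 1 + 1) (by omega), ← hp]
          ring
    intro d hd
    rcases Nat.lt_or_ge d (r + 1) with h | h
    · exact hlow d (by simpa using h)
    · obtain rfl : d = r + 1 := by simp at hd; omega
      exact single_mem_of_forall_single_mem hsat hPV (S := Finset.range (r + 1)) (by simp) hPr
        (fun i hi => hP i (by simp at hi; omega)) hlow

/-- If no nontrivial power of a solution of `a y' = b y` is rational, then a saturated submodule
that is stable under the derivation contains all the monomials in `y` of each of its elements. -/
lemma single_mem_of_homogeneous
    (hno : ∀ p g : F[X], p ≠ 0 → g ≠ 0 → ∀ j : ℕ, 0 < j →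
      p * (a * derivative g) - g * (a * derivative p) + j * b * g * p ≠ 0)
    {V : Submodule F[X] (ℕ → F[X])}
    (hsat : ∀ (r : F[X]) (Q : ℕ → F[X]), r ≠ 0 → r • Q ∈ V → Q ∈ V)
    (hD : ∀ Q ∈ V, odeDerivation a b 0 Q ∈ V) (S : Finset ℕ) :
    ∀ P ∈ V, (∀ i, P i ≠ 0 ↔ i ∈ S) → ∀ d ∈ S, (Pi.single d 1 : ℕ → F[X]) ∈ V := by
  induction S using Finset.induction_on with
  | empty => simp
  | insert e S he ih =>
    intro P hPV hP
    have hPe : P e ≠ 0 := (hP e).mpr (Finset.mem_insert_self _ _)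
    have hlow : ∀ d ∈ S, (Pi.single d 1 : ℕ → F[X]) ∈ V := by
      refine ih (P e • odeDerivation a b 0 P - (a * derivative (P e) + (e : F[X]) * b * P e) • P)
        (V.sub_mem (V.smul_mem _ (hD _ hPV)) (V.smul_mem _ hPV)) fun i => ?_
      simp only [Pi.sub_apply, Pi.smul_apply, smul_eq_mul, odeDerivation]
      constructor
      · intro h
        by_contra hi
        rcases eq_or_ne i e with rfl | hie
        · exact h (by ring)
        · have : P i = 0 := by
            by_contra h0
            exact hi (Finset.mem_of_mem_insert_of_ne ((hP i).mp h0) hie)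
          exact h (by rw [this]; simp)
      · intro hi h
        have hPi : P i ≠ 0 := (hP i).mpr (Finset.mem_insert_of_mem hi)
        have hie : i ≠ e := fun h => he (h ▸ hi)
        rcases lt_or_gt_of_ne hie with hlt | hlt
        · obtain ⟨j, rfl⟩ := Nat.exists_eq_add_of_lt hlt
          refine hno (P i) (P (i + j + 1)) hPi hPe (j + 1) (by omega) ?_
          push_cast at h ⊢
          linear_combination -h
        · obtain ⟨j, rfl⟩ := Nat.exists_eq_add_of_lt hlt
          refine hno (P e) (P (e + j + 1)) hPe hPi (j + 1) (by omega) ?_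
          push_cast at h ⊢
          linear_combination h
    intro d hd
    rcases Finset.mem_insert.mp hd with rfl | h
    · exact single_mem_of_forall_single_mem hsat hPV he hPe
        (fun i hi => by by_contra h0; exact hi ((hP i).mp h0)) hlow
    · exact hlow d h

lemma odeDerivation_mem_saturation_span {P : ℕ → F[X]} {m : ℕ}
    (hm : (odeDerivation a b c)^[m] P ∈
      saturation (Submodule.span F[X] ((fun k => (odeDerivation a b c)^[k] P) '' Set.Iio m))) :
    ∀ Q ∈ saturation (Submodule.span F[X] ((fun k => (odeDerivation a b c)^[k] P) '' Set.Iio m)),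
      odeDerivation a b c Q ∈
        saturation (Submodule.span F[X] ((fun k => (odeDerivation a b c)^[k] P) '' Set.Iio m)) := by
  set W := Submodule.span F[X] ((fun k => (odeDerivation a b c)^[k] P) '' Set.Iio m) with hW
  have key : ∀ Q ∈ W, odeDerivation a b c Q ∈ saturation W := by
    intro Q hQ
    induction hQ using Submodule.span_induction with
    | mem x hx =>
      obtain ⟨k, hk, rfl⟩ := hx
      simp only [← Function.iterate_succ_apply' (odeDerivation a b c)]
      rcases Nat.lt_or_ge (k + 1) m with h | h
      · exact le_saturation _ (Submodule.subset_span ⟨k + 1, h, rfl⟩)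
      · obtain rfl : m = k + 1 := le_antisymm h hk
        exact hm
    | zero => rw [odeDerivation_zero]; exact Submodule.zero_mem _
    | add x y _ _ hx hy => rw [odeDerivation_add]; exact Submodule.add_mem _ hx hy
    | smul r x hxW hx =>
      rw [odeDerivation_smul]
      exact Submodule.add_mem _ (Submodule.smul_mem _ _ (le_saturation _ hxW))
        (Submodule.smul_mem _ _ hx)
  rintro Q ⟨r, hr, hQ⟩
  refine mem_saturation_of_smul_mem hr ?_
  have h := key _ hQ
  rw [odeDerivation_smul] at h
  have hQ' : Q ∈ saturation W := ⟨r, hr, hQ⟩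
  exact (Submodule.add_mem_iff_right _ (Submodule.smul_mem _ _ hQ')).mp h

/-- The coefficients of the first `#S` derivatives of a polynomial in the monomials `y ^ d`,
`d ∈ S`, form a nonsingular matrix as soon as these monomials are in every stable saturated
submodule containing the polynomial. -/
lemma det_iterate_odeDerivation_ne_zero {P : ℕ → F[X]} {S : Finset ℕ} {s : ℕ} (e : Fin s ≃ S)
    (hsupp : ∀ k, ∀ i ∉ S, ((odeDerivation a b c)^[k] P) i = 0)
    (hS : ∀ V : Submodule F[X] (ℕ → F[X]),
      (∀ (r : F[X]) (Q : ℕ → F[X]), r ≠ 0 → r • Q ∈ V → Q ∈ V) →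
      (∀ Q ∈ V, odeDerivation a b c Q ∈ V) → P ∈ V →
      ∀ d ∈ S, (Pi.single d 1 : ℕ → F[X]) ∈ V) :
    (Matrix.of fun (k l : Fin s) => ((odeDerivation a b c)^[k] P) (e l)).det ≠ 0 := by
  set M := Matrix.of fun (k l : Fin s) => ((odeDerivation a b c)^[k] P) (e l) with hM
  classical
  intro hdet
  obtain ⟨v, hv0, hv⟩ := Matrix.exists_vecMul_eq_zero_iff.mpr hdet
  have hrel : ∑ k : Fin s, v k • (odeDerivation a b c)^[k] P = 0 := by
    funext i
    by_cases hi : i ∈ S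
    · have := congrFun hv (e.symm ⟨i, hi⟩)
      simpa [Matrix.vecMul, dotProduct, hM, Finset.sum_apply] using this
    · simp [Finset.sum_apply, hsupp _ i hi]
  obtain ⟨k₀, hk₀⟩ := Function.ne_iff.mp hv0
  obtain ⟨m, hm, hmax⟩ := (Finset.univ.filter fun k => v k ≠ 0).exists_max_image id
    ⟨k₀, by simpa using hk₀⟩
  simp only [Finset.mem_filter, Finset.mem_univ, true_and, id] at hm hmax
  set W := Submodule.span F[X] ((fun k => (odeDerivation a b c)^[k] P) '' Set.Iio (m : ℕ)) with hW
  have hmem : (odeDerivation a b c)^[m] P ∈ saturation W := by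
    refine ⟨v m, hm, ?_⟩
    rw [← Finset.add_sum_erase _ _ (Finset.mem_univ m)] at hrel
    rw [eq_neg_of_add_eq_zero_left hrel]
    refine W.neg_mem (W.sum_mem fun k hk => ?_)
    by_cases hvk : v k = 0
    · simp [hvk]
    · refine W.smul_mem _ (Submodule.subset_span ⟨k, ?_, rfl⟩)
      exact lt_of_le_of_ne (hmax k hvk) (by simpa [Fin.ext_iff] using (Finset.ne_of_mem_erase hk))
  have hstable := odeDerivation_mem_saturation_span hmem
  have hPmem : P ∈ saturation W := by
    rcases Nat.eq_zero_or_pos (m : ℕ) with h | h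
    · rw [h] at hmem; exact hmem
    · exact le_saturation _ (Submodule.subset_span ⟨0, h, rfl⟩)
  have hsingle := hS _ (fun r Q hr => mem_saturation_of_smul_mem hr) hstable hPmem
  have hex : ∀ l : Fin s, ∃ r : F[X], r ≠ 0 ∧ ∃ w : Fin s → F[X],
      ∑ k, w k • (odeDerivation a b c)^[k] P = r • (Pi.single (e l : ℕ) 1 : ℕ → F[X]) := by
    intro l
    obtain ⟨r, hr, h⟩ := hsingle (e l) (e l).2
    refine ⟨r, hr, Submodule.mem_span_range_iff_exists_fun _ |>.mp (Submodule.span_mono ?_ h)⟩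
    rintro _ ⟨k, hk, rfl⟩
    exact ⟨⟨k, lt_trans hk m.2⟩, rfl⟩
  choose r hr w hw using hex
  have hmul : Matrix.of w * M = Matrix.diagonal r := by
    ext1 l l'
    have := congrFun (hw l) (e l')
    simp only [Finset.sum_apply, Pi.smul_apply, smul_eq_mul, Pi.single_apply] at this
    rw [Matrix.mul_apply, Matrix.diagonal_apply]
    simp only [Matrix.of_apply, hM]
    rw [this]
    by_cases h : l = l'
    · simp [h]
    · have : (e l' : ℕ) ≠ e l := fun h' => h (e.injective (Subtype.ext h')).symm
      simp [h, this]
  have := congrArg Matrix.det hmul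
  rw [Matrix.det_mul, hdet, mul_zero, Matrix.det_diagonal] at this
  exact Finset.prod_ne_zero_iff.mpr (fun l _ => hr l) this.symm

end ZeroEstimateAlgebra

section AnalyticOrder

lemma differentiable_polynomial_eval (p : ℂ[X]) : Differentiable ℂ fun z => p.eval z :=
  p.differentiable

lemma le_analyticOrderAt_sum {ι : Type*} (s : Finset ι) {F : ι → ℂ → ℂ} {z₀ : ℂ} {m : ℕ∞}
    (hF : ∀ i ∈ s, m ≤ analyticOrderAt (F i) z₀) :
    m ≤ analyticOrderAt (fun z => ∑ i ∈ s, F i z) z₀ := by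
  classical
  induction s using Finset.induction_on with
  | empty =>
    have : analyticOrderAt (fun _ : ℂ => (0 : ℂ)) z₀ = ⊤ := by simp [analyticOrderAt_eq_top]
    simp [this]
  | insert i s hi ih =>
    simp only [Finset.sum_insert hi]
    refine le_trans (le_min (hF i (by simp)) (ih fun j hj => hF j (by simp [hj]))) ?_
    exact le_analyticOrderAt_add

lemma le_analyticOrderAt_mul_deriv {w g : ℂ → ℂ} {z₀ : ℂ} (hw : AnalyticAt ℂ w z₀)
    (hg : AnalyticAt ℂ g z₀) {m : ℕ} (h : (m : ℕ∞) ≤ analyticOrderAt g z₀) :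
    ((m - 1 : ℕ) : ℕ∞) ≤ analyticOrderAt (fun z => w z * deriv g z) z₀ := by
  have hd : ((m - 1 : ℕ) : ℕ∞) ≤ analyticOrderAt (deriv g) z₀ := by
    rw [natCast_le_analyticOrderAt_iff_iteratedDeriv_eq_zero hg] at h
    rw [natCast_le_analyticOrderAt_iff_iteratedDeriv_eq_zero hg.deriv]
    intro i hi
    rw [← iteratedDeriv_succ']
    exact h _ (by omega)
  refine hd.trans ?_
  have := analyticOrderAt_mul hw hg.deriv
  change _ ≤ analyticOrderAt (w * deriv g) z₀
  rw [this]
  exact le_add_self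

lemma X_sub_C_pow_dvd_of_le_analyticOrderAt {p : ℂ[X]} {z₀ : ℂ} {j : ℕ}
    (h : (j : ℕ∞) ≤ analyticOrderAt (fun z => p.eval z) z₀) : (X - C z₀) ^ j ∣ p := by
  rcases eq_or_ne p 0 with rfl | hp
  · simp
  obtain ⟨q, hq, hq'⟩ := exists_eq_pow_rootMultiplicity_mul_and_not_dvd p hp z₀
  have hord : analyticOrderAt (fun z => p.eval z) z₀ = (rootMultiplicity z₀ p : ℕ) := by
    rw [((differentiable_polynomial_eval p).analyticAt z₀).analyticOrderAt_eq_natCast]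
    refine ⟨fun z => q.eval z, (differentiable_polynomial_eval q).analyticAt z₀, ?_, ?_⟩
    · rwa [Polynomial.dvd_iff_isRoot] at hq'
    · filter_upwards with z
      conv_lhs => rw [hq]
      simp
  rw [hord] at h
  exact (pow_dvd_pow _ (by exact_mod_cast h)).trans (pow_rootMultiplicity_dvd p z₀)

lemma add_le_natDegree_of_le_analyticOrderAt {p : ℂ[X]} (hp : p ≠ 0) {z₀ z₁ : ℂ} (hz : z₀ ≠ z₁)
    {i j : ℕ} (h₀ : (i : ℕ∞) ≤ analyticOrderAt (fun z => p.eval z) z₀)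
    (h₁ : (j : ℕ∞) ≤ analyticOrderAt (fun z => p.eval z) z₁) : i + j ≤ p.natDegree := by
  have hco : IsCoprime ((X - C z₀) ^ i) ((X - C z₁) ^ j) :=
    (isCoprime_X_sub_C_of_isUnit_sub (sub_ne_zero.mpr hz).isUnit).pow
  have hdvd := hco.mul_dvd (X_sub_C_pow_dvd_of_le_analyticOrderAt h₀)
    (X_sub_C_pow_dvd_of_le_analyticOrderAt h₁)
  have := natDegree_le_of_dvd hdvd hp
  rwa [natDegree_mul (pow_ne_zero _ (X_sub_C_ne_zero _)) (pow_ne_zero _ (X_sub_C_ne_zero _)),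
    natDegree_pow, natDegree_pow, natDegree_X_sub_C, natDegree_X_sub_C, mul_one, mul_one] at this

lemma analyticOrderAt_ne_top_of_ne_zero {g : ℂ → ℂ} (hg : Differentiable ℂ g) (h : g ≠ 0)
    (z₀ : ℂ) : analyticOrderAt g z₀ ≠ ⊤ := fun ht =>
  h (((AnalyticOnNhd.analyticOrderAt_eq_top_iff_eq_zero z₀) fun z => hg.analyticAt z).mp ht)

/-- Two entire functions with vanishing Wronskian are proportional. -/
lemma eq_const_mul_of_wronskian_eq_zero {w G Q : ℂ → ℂ} (hw : Differentiable ℂ w)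
    (hG : Differentiable ℂ G) (hQ : Differentiable ℂ Q) {z₀ : ℂ} (hwz : w z₀ ≠ 0)
    (hQz : Q z₀ ≠ 0) (h : ∀ z, w z * (deriv G z * Q z - G z * deriv Q z) = 0) :
    ∃ κ : ℂ, ∀ z, G z = κ * Q z := by
  refine ⟨G z₀ / Q z₀, ?_⟩
  set κ := G z₀ / Q z₀ with hκ
  set H : ℂ → ℂ := fun z => G z - κ * Q z with hH
  have hHd : Differentiable ℂ H := hG.sub (hQ.const_mul κ)
  by_contra hne
  have hH0 : H ≠ 0 := fun h0 => hne fun z => sub_eq_zero.mp (congrFun h0 z)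
  have hHz : H z₀ = 0 := by simp [hH, hκ, hQz]
  have hderiv : ∀ z, deriv H z = deriv G z - κ * deriv Q z := fun z => by
    rw [hH, deriv_fun_sub (hG z) ((hQ z).const_mul κ), deriv_const_mul κ (hQ z)]
  have heq : (w * Q) * deriv H = (w * deriv Q) * H := by
    funext z
    simp only [Pi.mul_apply]
    rw [hderiv]
    simp only [hH]
    linear_combination h z
  have han : ∀ {g : ℂ → ℂ}, Differentiable ℂ g → AnalyticAt ℂ g z₀ := fun hg => hg.analyticAt z₀
  have hord : analyticOrderAt ((w * Q) * deriv H) z₀ = analyticOrderAt ((w * deriv Q) * H) z₀ := by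
    rw [heq]
  rw [analyticOrderAt_mul ((han hw).mul (han hQ)) (han hHd).deriv,
    analyticOrderAt_mul ((han hw).mul (han hQ).deriv) (han hHd),
    analyticOrderAt_mul (han hw) (han hQ), (han hw).analyticOrderAt_eq_zero.mpr hwz,
    (han hQ).analyticOrderAt_eq_zero.mpr hQz, zero_add, zero_add] at hord
  have h1 := (han hHd).analyticOrderAt_deriv_add_one
  simp only [hHz, sub_zero] at h1
  have htop := analyticOrderAt_ne_top_of_ne_zero hHd hH0 z₀
  have hle : analyticOrderAt H z₀ ≤ analyticOrderAt (deriv H) z₀ := by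
    rw [hord]; exact le_add_self
  change analyticOrderAt (deriv H) z₀ + 1 = analyticOrderAt H z₀ at h1
  rw [← h1] at hle htop
  have htop' : analyticOrderAt (deriv H) z₀ ≠ ⊤ := fun h => htop (by simp [h])
  exact absurd hle (not_le.mpr ((ENat.lt_add_one_iff htop').mpr le_rfl))

end AnalyticOrder

section ZeroEstimate

/-- The function `z ↦ q(z, f(z))`, where `q` is a polynomial of degree at most `N` in its second
variable. -/
def evalAlong (N : ℕ) (q : ℕ → ℂ[X]) (f : ℂ → ℂ) (z : ℂ) : ℂ :=
  ∑ i ∈ Finset.range (N + 1), (q i).eval z * f z ^ i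

variable {f : ℂ → ℂ} {a b c : ℂ[X]} {N : ℕ}

lemma differentiable_evalAlong (hf : Differentiable ℂ f) (q : ℕ → ℂ[X]) :
    Differentiable ℂ (evalAlong N q f) := by
  unfold evalAlong
  exact Differentiable.fun_sum fun i _ => (differentiable_polynomial_eval _).mul (hf.pow i)

lemma mul_deriv_evalAlong (hf : Differentiable ℂ f)
    (heq : ∀ z : ℂ, a.eval z * deriv f z = b.eval z * f z + c.eval z)
    {q : ℕ → ℂ[X]} (hq : ∀ i > N, q i = 0) (z : ℂ) :
    a.eval z * deriv (evalAlong N q f) z = evalAlong N (odeDerivation a b c q) f z := by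
  have hd : HasDerivAt (evalAlong N q f) (∑ i ∈ Finset.range (N + 1),
      ((derivative (q i)).eval z * f z ^ i + (q i).eval z * (i * f z ^ (i - 1) * deriv f z))) z :=
    HasDerivAt.fun_sum fun i _ =>
      ((q i).hasDerivAt z).mul ((hf z).hasDerivAt.fun_pow i)
  rw [hd.deriv, Finset.mul_sum]
  have h1 : ∀ i, a.eval z * ((derivative (q i)).eval z * f z ^ i +
      (q i).eval z * (i * f z ^ (i - 1) * deriv f z)) =
      (a * derivative (q i) + i * b * q i).eval z * f z ^ i +
        (q i).eval z * i * c.eval z * f z ^ (i - 1) := by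
    intro i
    have : (i : ℂ) * f z ^ i = i * (f z ^ (i - 1) * f z) := by
      rcases i with _ | i
      · simp
      · simp [pow_succ]
    simp only [eval_add, eval_mul, eval_natCast]
    linear_combination (q i).eval z * i * f z ^ (i - 1) * heq z - (q i).eval z * b.eval z * this
  simp only [h1, Finset.sum_add_distrib]
  rw [Finset.sum_range_succ' (fun i => (q i).eval z * i * c.eval z * f z ^ (i - 1))]
  have h2 : evalAlong N (odeDerivation a b c q) f z = ∑ i ∈ Finset.range (N + 1),
      (a * derivative (q i) + i * b * q i).eval z * f z ^ i +
      ∑ i ∈ Finset.range (N + 1), ((i + 1 : ℂ) * c.eval z * (q (i + 1)).eval z) * f z ^ i := by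
    rw [evalAlong, ← Finset.sum_add_distrib]
    refine Finset.sum_congr rfl fun i _ => ?_
    simp [odeDerivation]
    ring
  rw [h2, Finset.sum_range_succ (fun i => ((i + 1 : ℂ) * c.eval z * (q (i + 1)).eval z) * f z ^ i),
    hq (N + 1) (by omega)]
  simp only [Nat.cast_zero, mul_zero, zero_mul, add_zero, eval_zero, Nat.add_sub_cancel]
  congr 1
  refine Finset.sum_congr rfl fun i _ => ?_
  push_cast
  ring

lemma le_analyticOrderAt_evalAlong_iterate (hf : Differentiable ℂ f)
    (heq : ∀ z : ℂ, a.eval z * deriv f z = b.eval z * f z + c.eval z)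
    {q : ℕ → ℂ[X]} (hq : ∀ i > N, q i = 0) {z₀ : ℂ} {m : ℕ}
    (hm : (m : ℕ∞) ≤ analyticOrderAt (evalAlong N q f) z₀) (k : ℕ) :
    ((m - k : ℕ) : ℕ∞) ≤ analyticOrderAt (evalAlong N ((odeDerivation a b c)^[k] q) f) z₀ := by
  induction k with
  | zero => simpa using hm
  | succ k ih =>
    rw [Function.iterate_succ_apply', ← Nat.sub_sub]
    have := le_analyticOrderAt_mul_deriv ((differentiable_polynomial_eval a).analyticAt z₀)
      ((differentiable_evalAlong (N := N) hf ((odeDerivation a b c)^[k] q)).analyticAt z₀) ih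
    rwa [funext (mul_deriv_evalAlong hf heq (odeDerivation_iterate_eq_zero a b c hq k))] at this

lemma natDegree_odeDerivation_iterate_le {A : Type*} [CommRing A] {a b c : A[X]} {e n : ℕ}
    (ha : a.natDegree ≤ e) (hb : b.natDegree ≤ e) (hc : c.natDegree ≤ e) {q : ℕ → A[X]}
    (hq : ∀ i, (q i).natDegree ≤ n) (k : ℕ) :
    ∀ i, (((odeDerivation a b c)^[k] q) i).natDegree ≤ n + k * e := by
  induction k with
  | zero => simpa using hq
  | succ k ih =>
    intro i
    rw [Function.iterate_succ_apply', odeDerivation]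
    have hmul : ∀ {p r : A[X]}, p.natDegree ≤ e → r.natDegree ≤ n + k * e →
        (p * r).natDegree ≤ n + (k + 1) * e := fun hp hr =>
      natDegree_mul_le.trans (by linarith)
    have hcast : ∀ (j : ℕ) {p : A[X]}, p.natDegree ≤ e → ((j : A[X]) * p).natDegree ≤ e :=
      fun j p hp => natDegree_mul_le.trans (by simpa using hp)
    refine natDegree_add_le_of_degree_le (natDegree_add_le_of_degree_le
      (hmul ha ((natDegree_derivative_le _).trans ((Nat.sub_le _ _).trans (ih i)))) ?_) ?_
    · exact hmul (hcast i hb) (ih i)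
    · exact hmul (by exact_mod_cast hcast (i + 1) hc) (ih (i + 1))

lemma natDegree_det_le_of_forall {s d : ℕ} (M : Matrix (Fin s) (Fin s) ℂ[X])
    (h : ∀ k l, (M k l).natDegree ≤ d) : M.det.natDegree ≤ s * d := by
  rw [Matrix.det_apply]
  refine natDegree_sum_le_of_forall_le _ _ fun σ _ => ?_
  refine (natDegree_smul_le _ _).trans ((natDegree_prod_le _ _).trans ?_)
  exact (Finset.sum_le_card_nsmul _ _ d fun i _ => h _ _).trans (by simp)

lemma add_le_of_det_ne_zero (hf : Differentiable ℂ f)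
    (heq : ∀ z : ℂ, a.eval z * deriv f z = b.eval z * f z + c.eval z)
    {e n : ℕ} (ha : a.natDegree ≤ e) (hb : b.natDegree ≤ e) (hc : c.natDegree ≤ e)
    {q : ℕ → ℂ[X]} (hq : ∀ i, (q i).natDegree ≤ n)
    {S : Finset ℕ} (hSN : S ⊆ Finset.range (N + 1)) (hSne : S.Nonempty)
    (hsupp : ∀ k, ∀ i ∉ S, ((odeDerivation a b c)^[k] q) i = 0)
    {s : ℕ} (ε : Fin s ≃ S)
    (hdet : (Matrix.of fun (k l : Fin s) => ((odeDerivation a b c)^[k] q) (ε l)).det ≠ 0)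
    {z₀ z₁ : ℂ} (hz : z₀ ≠ z₁) {u₀ u₁ m₀ m₁ : ℕ}
    (hu₀ : analyticOrderAt f z₀ = u₀) (hu₁ : analyticOrderAt f z₁ = u₁)
    (hm₀ : (m₀ : ℕ∞) ≤ analyticOrderAt (evalAlong N q f) z₀)
    (hm₁ : (m₁ : ℕ∞) ≤ analyticOrderAt (evalAlong N q f) z₁) :
    m₀ + m₁ ≤ (N + 1) * n + ((N + 1) * ((N + 1) * e) + 2 * (N + 1) + N * (u₀ + u₁)) := by
  set M := Matrix.of fun (k l : Fin s) => ((odeDerivation a b c)^[k] q) (ε l) with hM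
  have hs : s ≤ N + 1 := by
    have := Fintype.card_congr ε
    have h2 := Finset.card_le_card hSN
    simp at this h2
    omega
  have hqN : ∀ i > N, q i = 0 := fun i hi => hsupp 0 i fun h => by
    have := Finset.mem_range.mp (hSN h); omega
  obtain ⟨d, hd⟩ := hSne
  set l := ε.symm ⟨d, hd⟩ with hl
  have hdN : d ≤ N := by have := Finset.mem_range.mp (hSN hd); omega
  have hval : ∀ (k : Fin s) (z : ℂ), evalAlong N ((odeDerivation a b c)^[k] q) f z =
      ∑ l' : Fin s, (M k l').eval z * f z ^ (ε l' : ℕ) := by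
    intro k z
    rw [evalAlong, ← Finset.sum_subset hSN fun i _ hi => by simp [hsupp k i hi],
      ← Finset.sum_coe_sort S, ← ε.sum_comp]
    rfl
  have hcramer : ∀ z, ∑ k : Fin s, (M.adjugate l k).eval z *
      evalAlong N ((odeDerivation a b c)^[k] q) f z = M.det.eval z * f z ^ d := by
    intro z
    simp only [hval, Finset.mul_sum]
    rw [Finset.sum_comm]
    have : ∀ l' : Fin s, ∑ k : Fin s, (M.adjugate l k).eval z *
        ((M k l').eval z * f z ^ (ε l' : ℕ)) = if l = l' then M.det.eval z * f z ^ d else 0 := by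
      intro l'
      have h := congrFun (congrFun M.adjugate_mul l) l'
      rw [Matrix.mul_apply, Matrix.smul_apply, Matrix.one_apply] at h
      have h := congrArg (eval z) h
      rw [eval_finsetSum] at h
      simp only [eval_mul] at h
      simp only [← mul_assoc]
      rw [← Finset.sum_mul, h]
      split_ifs with hll
      · subst hll; simp [hl]
      · simp
    simp [this]
  have hord : ∀ {z : ℂ} {u m : ℕ}, analyticOrderAt f z = u →
      (m : ℕ∞) ≤ analyticOrderAt (evalAlong N q f) z →
      ((m - (N + 1) - N * u : ℕ) : ℕ∞) ≤ analyticOrderAt (fun z => M.det.eval z) z := by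
    intro z u m hu hm
    have h1 : ((m - (N + 1) : ℕ) : ℕ∞) ≤ analyticOrderAt (fun z => M.det.eval z * f z ^ d) z := by
      rw [← funext hcramer]
      refine le_analyticOrderAt_sum _ fun k _ => ?_
      have han := (differentiable_evalAlong (N := N) hf ((odeDerivation a b c)^[k] q)).analyticAt z
      have := analyticOrderAt_mul
        ((differentiable_polynomial_eval (M.adjugate l k)).analyticAt z) han
      change _ ≤ analyticOrderAt ((fun z => (M.adjugate l k).eval z) *
        (evalAlong N ((odeDerivation a b c)^[k] q) f)) z
      rw [this]
      refine le_trans ?_ le_add_self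
      refine le_trans ?_ (le_analyticOrderAt_evalAlong_iterate hf heq hqN hm k)
      have := k.2
      exact_mod_cast (by omega)
    have h2 : analyticOrderAt (fun z => M.det.eval z * f z ^ d) z =
        analyticOrderAt (fun z => M.det.eval z) z + d * u := by
      change analyticOrderAt ((fun z => M.det.eval z) * f ^ d) z = _
      rw [analyticOrderAt_mul ((differentiable_polynomial_eval _).analyticAt z)
        ((hf.analyticAt z).pow d), analyticOrderAt_pow (hf.analyticAt z), hu, nsmul_eq_mul]
    rw [h2] at h1
    have hdu : d * u ≤ N * u := Nat.mul_le_mul_right _ hdN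
    generalize analyticOrderAt (fun z => M.det.eval z) z = o at h1 ⊢
    induction o using ENat.recTopCoe with
    | top => simp
    | coe o =>
      norm_cast at h1 ⊢
      omega
  have hfin := add_le_natDegree_of_le_analyticOrderAt hdet hz (hord hu₀ hm₀) (hord hu₁ hm₁)
  have hdeg : M.det.natDegree ≤ s * (n + s * e) := natDegree_det_le_of_forall M fun k l' =>
    (natDegree_odeDerivation_iterate_le ha hb hc hq k _).trans (by gcongr; exact k.2.le)
  have hle : s * (n + s * e) ≤ (N + 1) * (n + (N + 1) * e) := by gcongr
  have h3 : (N + 1) * (n + (N + 1) * e) = (N + 1) * n + (N + 1) * ((N + 1) * e) := by ring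
  have h4 : N * (u₀ + u₁) = N * u₀ + N * u₁ := by ring
  omega

lemma evalAlong_ne_zero (htr : ¬ IsAlgebraicFunc f) {P : ℕ → ℂ[X]} (hP : P ≠ 0)
    (hPN : ∀ i > N, P i = 0) : evalAlong N P f ≠ 0 := by
  intro h
  refine htr ⟨∑ i ∈ Finset.range (N + 1), C (P i) * X ^ i, fun h0 => hP ?_, fun z => ?_⟩
  · funext j
    have := congrArg (fun Q => coeff Q j) h0
    simp only [finsetSum_coeff, coeff_C_mul_X_pow, coeff_zero] at this
    rcases Nat.lt_or_ge N j with hj | hj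
    · exact hPN j hj
    · rw [Finset.sum_ite_eq, if_pos (by simp; omega)] at this
      exact this
  · have := congrFun h z
    simpa [evalAlong, eval_finsetSum] using this

lemma ne_zero_of_not_isAlgebraicFunc (htr : ¬ IsAlgebraicFunc f) : f ≠ 0 := by
  rintro rfl
  exact htr ⟨X, X_ne_zero, by simp⟩

lemma not_isAlgebraicFunc_mul_sub (htr : ¬ IsAlgebraicFunc f) {p g : ℂ[X]} (hp : p ≠ 0) :
    ¬ IsAlgebraicFunc fun z => p.eval z * f z - g.eval z := by
  rintro ⟨P, hP, h⟩
  refine htr ⟨P.comp (C p * X - C g), fun h0 => hP ?_, fun z => ?_⟩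
  · rw [comp_eq_zero_iff] at h0
    rcases h0 with h0 | ⟨_, h0⟩
    · exact h0
    · have := congrArg (fun Q => coeff Q 1) h0
      simp [coeff_C] at this
      exact absurd this hp
  · have := h z
    rw [eval_comp]
    simp only [eval_sub, eval_mul, eval_C, eval_X]
    rw [← coe_evalRingHom, ← eval₂_at_apply] at this ⊢
    convert this using 2
    simp

/-- The zero estimate for solutions of homogeneous equations. -/
lemma exists_zero_estimate_of_homogeneous (hf : Differentiable ℂ f) (htr : ¬ IsAlgebraicFunc f)
    (ha : a ≠ 0) (heq : ∀ z : ℂ, a.eval z * deriv f z = b.eval z * f z)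
    {z₀ z₁ : ℂ} (hz : z₀ ≠ z₁) (N : ℕ) :
    ∃ B : ℕ, ∀ (n : ℕ) (P : ℕ → ℂ[X]), P ≠ 0 → (∀ i > N, P i = 0) → (∀ i, (P i).natDegree ≤ n) →
      ∀ m₀ m₁ : ℕ, (m₀ : ℕ∞) ≤ analyticOrderAt (evalAlong N P f) z₀ →
        (m₁ : ℕ∞) ≤ analyticOrderAt (evalAlong N P f) z₁ → m₀ + m₁ ≤ (N + 1) * n + B := by
  have hf0 := ne_zero_of_not_isAlgebraicFunc htr
  obtain ⟨u₀, hu₀⟩ := ENat.ne_top_iff_exists.mp (analyticOrderAt_ne_top_of_ne_zero hf hf0 z₀)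
  obtain ⟨u₁, hu₁⟩ := ENat.ne_top_iff_exists.mp (analyticOrderAt_ne_top_of_ne_zero hf hf0 z₁)
  have hno : ∀ p g : ℂ[X], p ≠ 0 → g ≠ 0 → ∀ j : ℕ, 0 < j →
      p * (a * derivative g) - g * (a * derivative p) + j * b * g * p ≠ 0 := by
    intro p g hp hg j hj h
    obtain ⟨z, hz⟩ : ∃ z, (a * p).eval z ≠ 0 := by
      by_contra! h0
      exact mul_ne_zero ha hp (Polynomial.funext (by simpa using h0))
    rw [eval_mul] at hz
    have hgd := differentiable_polynomial_eval g
    obtain ⟨κ, hκ⟩ := eq_const_mul_of_wronskian_eq_zero (w := fun z => a.eval z)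
      (G := fun z => g.eval z * f z ^ j) (Q := fun z => p.eval z)
      (differentiable_polynomial_eval a) (hgd.mul (hf.pow j)) (differentiable_polynomial_eval p)
      (left_ne_zero_of_mul hz) (right_ne_zero_of_mul hz) (by
        intro z
        have hd : HasDerivAt (fun z => g.eval z * f z ^ j)
            ((derivative g).eval z * f z ^ j + g.eval z * (j * f z ^ (j - 1) * deriv f z)) z :=
          (g.hasDerivAt z).mul ((hf z).hasDerivAt.fun_pow j)
        rw [hd.deriv, (p.hasDerivAt z).deriv]
        have h := congrArg (eval z) h
        simp only [eval_add, eval_sub, eval_mul, eval_natCast, eval_zero] at h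
        have hpow : f z ^ j = f z ^ (j - 1) * f z := by
          rw [← pow_succ, Nat.sub_add_cancel hj]
        linear_combination f z ^ j * h + p.eval z * g.eval z * j * f z ^ (j - 1) * heq z -
          p.eval z * g.eval z * j * b.eval z * hpow)
    refine evalAlong_ne_zero (N := j) (P := fun i => if i = j then g else if i = 0 then -C κ * p
      else 0) htr ?_ ?_ ?_
    · intro h0
      exact hg (by simpa using congrFun h0 j)
    · intro i hi
      rw [if_neg (by omega), if_neg (by omega)]
    · funext z
      rw [evalAlong, Finset.sum_range_succ, Finset.sum_eq_single_of_mem 0 (by simpa using hj)]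
      · rw [if_neg (by omega)]
        simp [hκ]
      · intro i hi h0
        rw [if_neg (by simp at hi; omega), if_neg h0]
        simp
  refine ⟨(N + 1) * ((N + 1) * max a.natDegree b.natDegree) + 2 * (N + 1) + N * (u₀ + u₁),
    fun n P hP hPN hPn m₀ m₁ hm₀ hm₁ => ?_⟩
  set S := (Finset.range (N + 1)).filter fun i => P i ≠ 0 with hS
  have hPS : ∀ i, P i ≠ 0 ↔ i ∈ S := by
    intro i
    simp only [hS, Finset.mem_filter, Finset.mem_range]
    refine ⟨fun h => ⟨?_, h⟩, fun h => h.2⟩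
    by_contra h'
    exact h (hPN i (by omega))
  have hsupp : ∀ k, ∀ i ∉ S, ((odeDerivation a b 0)^[k] P) i = 0 := by
    intro k
    induction k with
    | zero => intro i hi; by_contra h; exact hi ((hPS i).mp h)
    | succ k ih =>
      intro i hi
      rw [Function.iterate_succ_apply', odeDerivation, ih i hi]
      simp
  obtain ⟨d, hd⟩ := Function.ne_iff.mp hP
  refine add_le_of_det_ne_zero (c := 0) hf (by simpa using heq)
    (le_max_left a.natDegree b.natDegree) (le_max_right _ _) (by simp) hPn
    (Finset.filter_subset _ _) ⟨d, (hPS d).mp hd⟩ hsupp S.equivFin.symm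
    (det_iterate_odeDerivation_ne_zero _ hsupp fun V hsat hD hPV => ?_) hz hu₀.symm hu₁.symm hm₀ hm₁
  exact single_mem_of_homogeneous hno hsat hD S P hPV hPS

lemma exists_evalAlong_mul_sub (f : ℂ → ℂ) (P : ℕ → ℂ[X]) (p g : ℂ[X]) {e n : ℕ}
    (hp : p.natDegree ≤ e) (hg : g.natDegree ≤ e) (hP : ∀ i, (P i).natDegree ≤ n) :
    ∃ Q : ℕ → ℂ[X], (∀ i > N, Q i = 0) ∧ (∀ i, (Q i).natDegree ≤ n + N * e) ∧
      ∀ z, evalAlong N Q (fun z => p.eval z * f z - g.eval z) z =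
        p.eval z ^ N * evalAlong N P f z := by
  refine ⟨fun d => ∑ i ∈ Finset.range (N + 1), (i.choose d : ℂ[X]) * P i * p ^ (N - i) *
    g ^ (i - d), ?_, ?_, ?_⟩
  · intro d hd
    refine Finset.sum_eq_zero fun i hi => ?_
    rw [Nat.choose_eq_zero_of_lt (by simp at hi; omega)]
    simp
  · intro d
    refine natDegree_sum_le_of_forall_le _ _ fun i hi => ?_
    have h1 : ((i.choose d : ℂ[X]) * P i).natDegree ≤ n :=
      natDegree_mul_le.trans (by simpa using hP i)
    have h2 : (p ^ (N - i)).natDegree ≤ (N - i) * e := natDegree_pow_le_of_le _ hp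
    have h3 : (g ^ (i - d)).natDegree ≤ i * e :=
      (natDegree_pow_le_of_le _ hg).trans (Nat.mul_le_mul_right _ (Nat.sub_le _ _))
    have h4 : (N - i) * e + i * e = N * e := by
      rw [← add_mul, Nat.sub_add_cancel (by simp at hi; omega)]
    exact natDegree_mul_le.trans (by
      have := natDegree_mul_le (p := (i.choose d : ℂ[X]) * P i) (q := p ^ (N - i))
      omega)
  · intro z
    simp only [evalAlong, eval_finsetSum, Finset.sum_mul, Finset.mul_sum]
    rw [Finset.sum_comm]
    refine Finset.sum_congr rfl fun i hi => ?_
    have hi : i ≤ N := by simp at hi; omega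
    have h1 : p.eval z ^ N = p.eval z ^ (N - i) * p.eval z ^ i := by
      rw [← pow_add, Nat.sub_add_cancel hi]
    have h2 : p.eval z ^ i * f z ^ i = ∑ d ∈ Finset.range (N + 1),
        (p.eval z * f z - g.eval z) ^ d * g.eval z ^ (i - d) * i.choose d := by
      rw [← mul_pow]
      conv_lhs => rw [← sub_add_cancel (p.eval z * f z) (g.eval z), add_pow]
      refine Finset.sum_subset (by simpa using hi) fun d _ hd => ?_
      rw [Nat.choose_eq_zero_of_lt (by simp at hd; omega)]
      simp
    rw [h1]
    calc _ = (P i).eval z * p.eval z ^ (N - i) * (p.eval z ^ i * f z ^ i) := by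
          rw [h2, Finset.mul_sum]
          refine Finset.sum_congr rfl fun d _ => ?_
          simp only [eval_mul, eval_natCast, eval_pow]
          ring
      _ = _ := by ring

/-- The zero estimate for polynomials in `z` and a transcendental solution of a first-order
equation. -/
theorem exists_zero_estimate (hf : Differentiable ℂ f) (htr : ¬ IsAlgebraicFunc f)
    (ha : a ≠ 0) (heq : ∀ z : ℂ, a.eval z * deriv f z = b.eval z * f z + c.eval z)
    {z₀ z₁ : ℂ} (hz : z₀ ≠ z₁) (N : ℕ) :
    ∃ B : ℕ, ∀ (n : ℕ) (P : ℕ → ℂ[X]), P ≠ 0 → (∀ i > N, P i = 0) → (∀ i, (P i).natDegree ≤ n) →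
      ∀ m₀ m₁ : ℕ, (m₀ : ℕ∞) ≤ analyticOrderAt (evalAlong N P f) z₀ →
        (m₁ : ℕ∞) ≤ analyticOrderAt (evalAlong N P f) z₁ → m₀ + m₁ ≤ (N + 1) * n + B := by
  by_cases hno : ∀ p g : ℂ[X], p ≠ 0 →
      p * (a * derivative g) - g * (a * derivative p) ≠ b * g * p + c * p ^ 2
  · have hf0 := ne_zero_of_not_isAlgebraicFunc htr
    obtain ⟨u₀, hu₀⟩ := ENat.ne_top_iff_exists.mp (analyticOrderAt_ne_top_of_ne_zero hf hf0 z₀)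
    obtain ⟨u₁, hu₁⟩ := ENat.ne_top_iff_exists.mp (analyticOrderAt_ne_top_of_ne_zero hf hf0 z₁)
    refine ⟨(N + 1) * ((N + 1) * max a.natDegree (max b.natDegree c.natDegree)) +
      2 * (N + 1) + N * (u₀ + u₁),
      fun n P hP hPN hPn m₀ m₁ hm₀ hm₁ => ?_⟩
    obtain ⟨d, hd⟩ := Function.ne_iff.mp hP
    have hdN : d ≤ N := by
      by_contra h
      exact hd (hPN d (by omega))
    set r := Nat.findGreatest (fun i => P i ≠ 0) N with hr
    have hPr : P r ≠ 0 := Nat.findGreatest_spec (P := fun i => P i ≠ 0) hdN hd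
    have hrN : r ≤ N := Nat.findGreatest_le N
    have hPr' : ∀ i > r, P i = 0 := by
      intro i hi
      rcases Nat.lt_or_ge N i with h | h
      · exact hPN i h
      · exact not_not.mp (Nat.findGreatest_is_greatest hi h)
    have hsupp : ∀ k, ∀ i ∉ Finset.range (r + 1), ((odeDerivation a b c)^[k] P) i = 0 :=
      fun k i hi => odeDerivation_iterate_eq_zero a b c hPr' k i (by simp at hi; omega)
    exact add_le_of_det_ne_zero (e := max a.natDegree (max b.natDegree c.natDegree)) hf heq
      (by simp) (by simp) (by simp) hPn
      (by simpa using hrN) ⟨0, by simp⟩ hsupp (Finset.range (r + 1)).equivFin.symm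
      (det_iterate_odeDerivation_ne_zero _ hsupp fun V hsat hD hPV =>
        single_mem_of_no_rational_solution hno hsat hD r P hPV hPr hPr')
      hz hu₀.symm hu₁.symm hm₀ hm₁
  · push Not at hno
    obtain ⟨p, g, hp, hpg⟩ := hno
    have hpd := differentiable_polynomial_eval p
    have hgd := differentiable_polynomial_eval g
    obtain ⟨B, hB⟩ := exists_zero_estimate_of_homogeneous
      (f := fun z => p.eval z * f z - g.eval z) (a := p * a)
      (b := a * derivative p + b * p) ((hpd.mul hf).sub hgd)
      (not_isAlgebraicFunc_mul_sub (g := g) htr hp) (mul_ne_zero hp ha) (by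
        intro z
        have hd : HasDerivAt (fun z => p.eval z * f z - g.eval z)
            ((derivative p).eval z * f z + p.eval z * deriv f z - (derivative g).eval z) z :=
          ((p.hasDerivAt z).mul (hf z).hasDerivAt).sub (g.hasDerivAt z)
        have hpg := congrArg (eval z) hpg
        simp only [eval_add, eval_sub, eval_mul, eval_pow] at hpg ⊢
        change _ * deriv (fun z => p.eval z * f z - g.eval z) z = _
        rw [hd.deriv]
        linear_combination p.eval z ^ 2 * heq z - hpg) hz N
    refine ⟨(N + 1) * (N * max p.natDegree g.natDegree) + B,
      fun n P hP hPN hPn m₀ m₁ hm₀ hm₁ => ?_⟩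
    obtain ⟨Q, hQN, hQn, hQ⟩ := exists_evalAlong_mul_sub (N := N) f P p g
      (le_max_left p.natDegree g.natDegree) (le_max_right _ _) hPn
    have hQ0 : Q ≠ 0 := by
      rintro rfl
      have hne := evalAlong_ne_zero htr hP hPN
      have : (fun z => p.eval z ^ N) * evalAlong N P f = 0 := by
        funext z
        simpa [evalAlong] using (hQ z).symm
      have hor := (AnalyticOnNhd.eq_zero_or_eq_zero_of_mul_eq_zero (U := Set.univ)
        (fun z _ => (hpd.pow N).analyticAt z)
        (fun z _ => (differentiable_evalAlong (N := N) hf P).analyticAt z)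
        (fun z _ => congrFun this z) isPreconnected_univ)
      rcases hor with h | h
      · exact hp (Polynomial.funext fun z => by simpa using eq_zero_of_pow_eq_zero (h z trivial))
      · exact hne (funext fun z => h z trivial)
    have hord : ∀ {z : ℂ} {m : ℕ}, (m : ℕ∞) ≤ analyticOrderAt (evalAlong N P f) z →
        (m : ℕ∞) ≤ analyticOrderAt (evalAlong N Q fun z => p.eval z * f z - g.eval z) z := by
      intro z m hm
      rw [funext hQ]
      have := analyticOrderAt_mul ((hpd.pow N).analyticAt z)
        ((differentiable_evalAlong (N := N) hf P).analyticAt z)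
      change _ ≤ analyticOrderAt ((fun z => p.eval z ^ N) * evalAlong N P f) z
      refine hm.trans (le_trans le_add_self this.ge)
    have := hB _ Q hQ0 hQN hQn m₀ m₁ (hord hm₀) (hord hm₁)
    linarith

end ZeroEstimate

section House

open NumberField

variable {K : Type*} [Field K] [NumberField K]

lemma house_zero : house (0 : K) = 0 := by simp [house]

lemma house_natCast (n : ℕ) : house (n : K) = n := by simpa using house_intCast (K := K) n

/-- The sum of the houses of the coefficients of a polynomial. -/
def houseSum (p : K[X]) : ℝ := ∑ i ∈ p.support, house (p.coeff i)

lemma houseSum_nonneg (p : K[X]) : 0 ≤ houseSum p := Finset.sum_nonneg fun _ _ => house_nonneg _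

lemma houseSum_eq_of_subset {p : K[X]} {s : Finset ℕ} (h : p.support ⊆ s) :
    houseSum p = ∑ i ∈ s, house (p.coeff i) :=
  Finset.sum_subset h fun i _ hi => by rw [notMem_support_iff.mp hi, house_zero]

lemma houseSum_zero : houseSum (0 : K[X]) = 0 := by simp [houseSum]

lemma houseSum_add_le (p q : K[X]) : houseSum (p + q) ≤ houseSum p + houseSum q := by
  classical
  rw [houseSum_eq_of_subset support_add,
    houseSum_eq_of_subset (Finset.subset_union_left (s₁ := p.support) (s₂ := q.support)),
    houseSum_eq_of_subset (Finset.subset_union_right (s₁ := p.support) (s₂ := q.support)),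
    ← Finset.sum_add_distrib]
  exact Finset.sum_le_sum fun i _ => by rw [coeff_add]; exact house_add_le _ _

lemma houseSum_sum_le {ι : Type*} (s : Finset ι) (p : ι → K[X]) :
    houseSum (∑ i ∈ s, p i) ≤ ∑ i ∈ s, houseSum (p i) := by
  classical
  induction s using Finset.induction_on with
  | empty => simp [houseSum_zero]
  | insert i s hi ih =>
    rw [Finset.sum_insert hi, Finset.sum_insert hi]
    exact (houseSum_add_le _ _).trans (by gcongr)

lemma houseSum_monomial (n : ℕ) (x : K) : houseSum (monomial n x) = house x := by
  rw [houseSum_eq_of_subset (support_monomial_subset n x)]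
  simp

lemma houseSum_mul_le (p q : K[X]) : houseSum (p * q) ≤ houseSum p * houseSum q := by
  rw [mul_eq_sum_sum]
  refine (houseSum_sum_le _ _).trans ?_
  rw [houseSum, houseSum, Finset.sum_mul_sum]
  refine Finset.sum_le_sum fun i _ => ?_
  rw [Polynomial.sum]
  refine (houseSum_sum_le _ _).trans (Finset.sum_le_sum fun j _ => ?_)
  rw [houseSum_monomial]
  exact house_mul_le _ _

lemma houseSum_natCast_mul_le (n : ℕ) (p : K[X]) : houseSum ((n : K[X]) * p) ≤ n * houseSum p := by
  refine (houseSum_mul_le _ _).trans_eq ?_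
  rw [← C_eq_natCast, ← monomial_zero_left, houseSum_monomial, house_natCast]

lemma houseSum_derivative_le {p : K[X]} {n : ℕ} (hp : p.natDegree ≤ n) :
    houseSum (derivative p) ≤ n * houseSum p := by
  rw [derivative_apply, Polynomial.sum]
  refine (houseSum_sum_le _ _).trans ?_
  rw [houseSum, Finset.mul_sum]
  refine Finset.sum_le_sum fun i hi => ?_
  rw [C_mul_X_pow_eq_monomial, houseSum_monomial, mul_comm, house_nat_mul]
  have : i ≤ n := (le_natDegree_of_mem_supp _ hi).trans hp
  gcongr
  exact house_nonneg _

lemma house_eval_le {p : K[X]} {n : ℕ} (hp : p.natDegree ≤ n) {x : K} {r : ℝ} (hr : 1 ≤ r)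
    (hx : house x ≤ r) : house (p.eval x) ≤ houseSum p * r ^ n := by
  rw [eval_eq_sum, Polynomial.sum, houseSum, Finset.sum_mul]
  refine (house_sum_le_sum_house _ _).trans (Finset.sum_le_sum fun i hi => ?_)
  refine (house_mul_le _ _).trans (mul_le_mul_of_nonneg_left ?_ (house_nonneg _))
  calc house (x ^ i) ≤ house x ^ i := house_pow_le _ _
    _ ≤ r ^ i := pow_le_pow_left₀ (house_nonneg _) hx _
    _ ≤ r ^ n := pow_le_pow_right₀ hr ((le_natDegree_of_mem_supp _ hi).trans hp)

/-- The effect of iterating the derivation on the size of the coefficients. -/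
lemma houseSum_odeDerivation_iterate_le {a b c : K[X]} {e N n : ℕ} {L M : ℝ}
    (hae : a.natDegree ≤ e) (hbe : b.natDegree ≤ e) (hce : c.natDegree ≤ e)
    (ha : houseSum a ≤ L) (hb : houseSum b ≤ L) (hc : houseSum c ≤ L) {q : ℕ → K[X]}
    (hqN : ∀ i > N, q i = 0) (hqn : ∀ i, (q i).natDegree ≤ n) (hM : ∀ i, houseSum (q i) ≤ M)
    (k i : ℕ) {r : ℝ} (hr : L * (n + k * e + 2 * (N + 1)) ≤ r) :
    houseSum (((odeDerivation a b c)^[k] q) i) ≤ r ^ k * M := by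
  have hL : 0 ≤ L := (houseSum_nonneg _).trans ha
  have hM0 : 0 ≤ M := (houseSum_nonneg _).trans (hM 0)
  have hr0 : 0 ≤ r := le_trans (by positivity) hr
  induction k generalizing i with
  | zero => simpa using hM i
  | succ k ih =>
    have hrk : L * (n + k * e + 2 * (N + 1)) ≤ r := by
      refine le_trans ?_ hr
      gcongr
      simp
    rcases lt_or_ge N i with hi | hi
    · rw [odeDerivation_iterate_eq_zero a b c hqN _ i hi, houseSum_zero]
      positivity
    rw [Function.iterate_succ_apply', odeDerivation]
    set Q := (odeDerivation a b c)^[k] q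
    have hQ : ∀ i, houseSum (Q i) ≤ r ^ k * M := fun i => ih i hrk
    have hQn : (Q i).natDegree ≤ n + k * e :=
      natDegree_odeDerivation_iterate_le hae hbe hce hqn k i
    have h1 : houseSum (a * derivative (Q i)) ≤ L * ((n + k * e) * (r ^ k * M)) := by
      refine (houseSum_mul_le _ _).trans ?_
      have := houseSum_derivative_le hQn
      push_cast at this
      gcongr
      · exact houseSum_nonneg _
      · exact this.trans (by gcongr; exact hQ i)
    have h2 : houseSum ((i : K[X]) * b * Q i) ≤ (N + 1) * L * (r ^ k * M) := by
      refine (houseSum_mul_le _ _).trans ?_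
      gcongr
      · exact houseSum_nonneg _
      · refine (houseSum_natCast_mul_le _ _).trans ?_
        gcongr
        · exact houseSum_nonneg _
        · exact_mod_cast (by omega : i ≤ N + 1)
      · exact hQ i
    have h3 : houseSum (((i : K[X]) + 1) * c * Q (i + 1)) ≤ (N + 1) * L * (r ^ k * M) := by
      refine (houseSum_mul_le _ _).trans ?_
      gcongr
      · exact houseSum_nonneg _
      · have := houseSum_natCast_mul_le (i + 1) c
        push_cast at this
        refine this.trans ?_
        gcongr
        exact houseSum_nonneg _
      · exact hQ _
    calc _ ≤ L * ((n + k * e) * (r ^ k * M)) + (N + 1) * L * (r ^ k * M) +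
          (N + 1) * L * (r ^ k * M) :=
          (houseSum_add_le _ _).trans (add_le_add ((houseSum_add_le _ _).trans
            (add_le_add h1 h2)) h3)
      _ = L * (n + k * e + 2 * (N + 1)) * (r ^ k * M) := by ring
      _ ≤ r * (r ^ k * M) := by gcongr
      _ = r ^ (k + 1) * M := by ring

lemma isIntegral_natCast_pow_mul_eval {K : Type*} [Field K] {p : (𝓞 K)[X]} {n : ℕ} (hp : p.natDegree ≤ n)
    {x : K}
    {d : ℕ} (hd : IsIntegral ℤ (d * x)) :
    IsIntegral ℤ ((d : K) ^ n * (p.map (algebraMap (𝓞 K) K)).eval x) := by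
  rw [eval_map, eval₂_eq_sum_range, Finset.mul_sum]
  refine IsIntegral.sum _ fun i hi => ?_
  have hin : i ≤ n := by simp at hi; omega
  have : (d : K) ^ n * (algebraMap (𝓞 K) K (p.coeff i) * x ^ i) =
      (d : K) ^ (n - i) * (algebraMap (𝓞 K) K (p.coeff i) * (d * x) ^ i) := by
    rw [← Nat.sub_add_cancel hin, pow_add]
    simp only [Nat.add_sub_cancel]
    ring
  rw [this]
  exact ((isIntegral_natCast _).pow _).mul ((RingOfIntegers.isIntegral_coe _).mul (hd.pow _))

/-- Liouville's inequality for a nonzero algebraic integer. -/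
lemma one_le_norm_mul_house_pow {x : K} (hx : IsIntegral ℤ x) (h0 : x ≠ 0) (φ : K →+* ℂ) :
    1 ≤ ‖φ x‖ * house x ^ (Module.finrank ℚ K - 1) := by
  refine le_trans ?_ (norm_norm_le_norm_mul_house_pow x φ)
  have hn : Algebra.norm ℚ x ≠ 0 := by simpa using h0
  obtain ⟨m, hm⟩ := IsIntegrallyClosed.isIntegral_iff.mp (Algebra.isIntegral_norm ℚ hx)
  rw [← hm] at hn ⊢
  have hm0 : m ≠ 0 := by rintro rfl; simp at hn
  rw [eq_intCast, ← Rat.norm_cast_real, Rat.cast_intCast, Real.norm_eq_abs]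
  exact_mod_cast Int.one_le_abs hm0

end House

section EntireSeries

variable {u : ℕ → ℂ} {g : ℂ → ℂ}

lemma hasFPowerSeriesOnBall_of_forall_hasSum (h : ∀ z, HasSum (fun n => u n * z ^ n) (g z)) :
    HasFPowerSeriesOnBall g (FormalMultilinearSeries.ofScalars ℂ u) 0 ⊤ where
  r_le := by
    refine (FormalMultilinearSeries.radius_eq_top_of_summable_norm _ fun r => ?_).ge
    simpa [FormalMultilinearSeries.ofScalars_norm] using (h r).summable.norm
  r_pos := ENNReal.zero_lt_top
  hasSum {z} _ := by
    simpa [FormalMultilinearSeries.ofScalars_apply_eq, mul_comm] using h z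

lemma differentiable_of_forall_hasSum (h : ∀ z, HasSum (fun n => u n * z ^ n) (g z)) :
    Differentiable ℂ g := fun z =>
  ((hasFPowerSeriesOnBall_of_forall_hasSum h).differentiableOn z (by simp)).differentiableAt
    (by simp)

lemma iteratedDeriv_zero_of_forall_hasSum (h : ∀ z, HasSum (fun n => u n * z ^ n) (g z)) (n : ℕ) :
    iteratedDeriv n g 0 = n.factorial * u n := by
  have hp := (hasFPowerSeriesOnBall_of_forall_hasSum h).hasFPowerSeriesAt
  have := congrArg (fun p => FormalMultilinearSeries.coeff p n)
    (((differentiable_of_forall_hasSum h).analyticAt 0).hasFPowerSeriesAt.eq_formalMultilinearSeries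
      hp)
  simp only [FormalMultilinearSeries.coeff_ofScalars] at this
  rw [← this, mul_div_cancel₀ _ (Nat.cast_ne_zero.mpr n.factorial_ne_zero)]

lemma le_analyticOrderAt_zero_of_forall_hasSum (h : ∀ z, HasSum (fun n => u n * z ^ n) (g z))
    {T : ℕ} (hT : ∀ n < T, u n = 0) : (T : ℕ∞) ≤ analyticOrderAt g 0 := by
  rw [natCast_le_analyticOrderAt_iff_iteratedDeriv_eq_zero
    ((differentiable_of_forall_hasSum h).analyticAt 0)]
  intro i hi
  rw [iteratedDeriv_zero_of_forall_hasSum h, hT i hi, mul_zero]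

/-- A bound for a series of exponential type whose first terms vanish. -/
lemma norm_le_of_forall_hasSum {z w : ℂ} {T : ℕ} {v : ℕ → ℂ} {M R : ℝ}
    (h : HasSum (fun n => v n / n.factorial * z ^ n) w) (hT : ∀ n < T, v n = 0)
    (hv : ∀ n, ‖v n‖ * ‖z‖ ^ n ≤ M * R ^ n) (hR : 0 ≤ R) (hM : 0 ≤ M) :
    ‖w‖ ≤ M * R ^ T * Real.exp R / T.factorial := by
  have h' := (hasSum_nat_add_iff' T).mpr h
  rw [Finset.sum_eq_zero (fun i hi => by rw [hT i (by simpa using hi)]; simp), sub_zero] at h'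
  have hexp : HasSum (fun n => M * R ^ T / T.factorial * (R ^ n / n.factorial))
      (M * R ^ T / T.factorial * Real.exp R) := by
    rw [Real.exp_eq_exp_ℝ]
    exact (NormedSpace.expSeries_div_hasSum_exp R).mul_left _
  refine (h'.norm_le_of_bounded hexp fun n => ?_).trans_eq (by ring)
  rw [norm_mul, norm_div, norm_pow, Complex.norm_natCast, div_mul_eq_mul_div, div_mul_div_comm]
  have hfac : ((T.factorial * n.factorial : ℕ) : ℝ) ≤ (n + T).factorial := by
    rw [add_comm]
    exact_mod_cast Nat.le_of_dvd (Nat.factorial_pos _)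
      (Nat.factorial_mul_factorial_dvd_factorial_add T n)
  push_cast at hfac
  refine div_le_div₀ (by positivity) ((hv _).trans_eq (by ring)) (by positivity) hfac

end EntireSeries

section DerivativeAtPoint

variable {a b c : ℂ[X]} {f : ℂ → ℂ} {N : ℕ}

lemma iteratedDeriv_mul_deriv {w g : ℂ → ℂ} (hw : Differentiable ℂ w) (hg : Differentiable ℂ g)
    {z : ℂ} {k : ℕ} (h : ∀ i < k + 1, iteratedDeriv i g z = 0) :
    (∀ i < k, iteratedDeriv i (fun z => w z * deriv g z) z = 0) ∧
      iteratedDeriv k (fun z => w z * deriv g z) z = w z * iteratedDeriv (k + 1) g z := by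
  have hmul : ∀ i, iteratedDeriv i (fun z => w z * deriv g z) z = ∑ j ∈ Finset.range (i + 1),
      i.choose j * iteratedDeriv j w z * iteratedDeriv (i - j + 1) g z := by
    intro i
    rw [iteratedDeriv_fun_mul (hw.analyticAt z).contDiffAt (hg.analyticAt z).deriv.contDiffAt]
    simp only [iteratedDeriv_succ']
  constructor
  · intro i hi
    rw [hmul]
    exact Finset.sum_eq_zero fun j _ => by rw [h _ (by omega), mul_zero]
  · rw [hmul, Finset.sum_eq_single_of_mem 0 (by simp)]
    · simp
    · intro j hj h0
      rw [h _ (by simp at hj; omega), mul_zero]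

lemma evalAlong_iterate_eq (hf : Differentiable ℂ f)
    (heq : ∀ z : ℂ, a.eval z * deriv f z = b.eval z * f z + c.eval z)
    {z : ℂ} (k : ℕ) {q : ℕ → ℂ[X]} (hq : ∀ i > N, q i = 0)
    (h : ∀ i < k, iteratedDeriv i (evalAlong N q f) z = 0) :
    evalAlong N ((odeDerivation a b c)^[k] q) f z =
      a.eval z ^ k * iteratedDeriv k (evalAlong N q f) z := by
  induction k generalizing q with
  | zero => simp
  | succ k ih =>
    obtain ⟨h0, h1⟩ := iteratedDeriv_mul_deriv (differentiable_polynomial_eval a)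
      (differentiable_evalAlong hf q) h
    rw [funext (mul_deriv_evalAlong hf heq hq)] at h0 h1
    rw [Function.iterate_succ_apply,
      ih (q := odeDerivation a b c q) (odeDerivation_iterate_eq_zero a b c hq 1) h0, h1]
    ring

end DerivativeAtPoint

section Powers

open NumberField

variable {K : Type*} [Field K]

/-- The Taylor coefficients (multiplied by factorials) of the powers of the function whose Taylor
coefficients are `s n / n!`. -/
def expPow (s : ℕ → K) : ℕ → ℕ → K
  | 0, n => if n = 0 then 1 else 0
  | j + 1, n => ∑ p ∈ Finset.HasAntidiagonal.antidiagonal n, n.choose p.1 * expPow s j p.1 * s p.2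

lemma hasSum_expPow {s : ℕ → K} {φ : K →+* ℂ} {f : ℂ → ℂ}
    (hs : ∀ z, HasSum (fun n => φ (s n) / n.factorial * z ^ n) (f z)) (j : ℕ) (z : ℂ) :
    HasSum (fun n => φ (expPow s j n) / n.factorial * z ^ n) (f z ^ j) := by
  induction j with
  | zero =>
    convert! hasSum_single (f := fun n => φ (expPow s 0 n) / n.factorial * z ^ n) 0 ?_ using 1
    · simp [expPow]
    · intro n hn
      simp [expPow, hn]
  | succ j ih =>
    have h1 := summable_norm_sum_mul_antidiagonal_of_summable_norm ih.summable.norm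
      (hs z).summable.norm
    have h2 := tsum_mul_tsum_eq_tsum_sum_antidiagonal_of_summable_norm ih.summable.norm
      (hs z).summable.norm
    rw [ih.tsum_eq, (hs z).tsum_eq] at h2
    rw [pow_succ, h2]
    convert! h1.of_norm.hasSum using 2 with n
    rw [expPow, map_sum, Finset.sum_div, Finset.sum_mul]
    refine Finset.sum_congr rfl fun p hp => ?_
    obtain ⟨i, l⟩ := p
    obtain rfl : i + l = n := by simpa using hp
    simp only [map_mul, map_natCast]
    rw [Nat.choose_symm_add, Nat.add_choose,
      Nat.cast_div (Nat.factorial_mul_factorial_dvd_factorial_add i l)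
      (by exact_mod_cast (Nat.mul_pos i.factorial_pos l.factorial_pos).ne')]
    have h0 : ∀ m : ℕ, (m.factorial : ℂ) ≠ 0 := fun m => by exact_mod_cast m.factorial_ne_zero
    have := h0 i
    have := h0 l
    have := h0 (i + l)
    push_cast
    field_simp
    ring

lemma isIntegral_expPow {s : ℕ → K} {d T : ℕ} (hd : ∀ m ≤ T, IsIntegral ℤ (d * s m)) (j : ℕ) :
    ∀ m ≤ T, IsIntegral ℤ ((d : K) ^ j * expPow s j m) := by
  induction j with
  | zero =>
    intro m _
    rw [expPow, pow_zero, one_mul]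
    split_ifs
    exacts [isIntegral_one, isIntegral_zero]
  | succ j ih =>
    intro m hm
    rw [expPow, Finset.mul_sum]
    refine IsIntegral.sum _ fun p hp => ?_
    have hp : p.1 + p.2 = m := by simpa using hp
    have : (d : K) ^ (j + 1) * (m.choose p.1 * expPow s j p.1 * s p.2) =
        m.choose p.1 * (((d : K) ^ j * expPow s j p.1) * (d * s p.2)) := by ring
    rw [this]
    exact (isIntegral_natCast _).mul ((ih _ (by omega)).mul (hd _ (by omega)))

variable [NumberField K]

lemma house_one : house (1 : K) = 1 := by simpa using house_natCast (K := K) 1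

lemma house_expPow_le {s : ℕ → K} {r : ℝ} (hs : ∀ n, house (s n) ≤ r ^ (n + 1)) (j n : ℕ) :
    house (expPow s j n) ≤ r ^ j * (j * r) ^ n := by
  have hr : 0 ≤ r := by simpa using (house_nonneg _).trans (hs 0)
  induction j generalizing n with
  | zero =>
    rw [expPow]
    rcases n with _ | n
    · simp [house_one]
    · simp [house_zero]
  | succ j ih =>
    rw [expPow]
    refine (house_sum_le_sum_house _ _).trans ?_
    have : r ^ (j + 1) * (((j + 1 : ℕ) : ℝ) * r) ^ n = ∑ p ∈ Finset.HasAntidiagonal.antidiagonal n,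
        n.choose p.1 * (r ^ j * (j * r) ^ p.1) * r ^ (p.2 + 1) := by
      rw [Nat.cast_succ, add_mul, one_mul, (Commute.all _ _).add_pow', Finset.mul_sum]
      refine Finset.sum_congr rfl fun p _ => ?_
      rw [nsmul_eq_mul]
      ring
    rw [this]
    refine Finset.sum_le_sum fun p _ => ?_
    refine (house_mul_le _ _).trans (mul_le_mul ?_ (hs _) (house_nonneg _) (by positivity))
    rw [house_nat_mul]
    gcongr
    exact ih _

end Powers

section AuxiliaryFunction

open NumberField

variable {K : Type*} [Field K] {N : ℕ}

/-- The polynomials `∑ i ≤ n, x i j * (n! / i!) * z ^ i`. -/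
def auxPoly {R : Type*} [CommRing R] (n N : ℕ) (x : ℕ → ℕ → R) (j : ℕ) : R[X] :=
  if j ≤ N then
    ∑ i ∈ Finset.range (n + 1), monomial i (((n.factorial / i.factorial : ℕ) : R) * x i j)
  else 0

/-- The Taylor coefficients, up to the factor `n! / m!`, of the auxiliary function. -/
def auxCoeff (s : ℕ → K) (n N : ℕ) (x : ℕ → ℕ → K) (m : ℕ) : K :=
  ∑ i ∈ Finset.range (n + 1), ∑ j ∈ Finset.range (N + 1),
    x i j * (m.choose i * expPow s j (m - i))

lemma auxPoly_eq_zero {R : Type*} [CommRing R] (n : ℕ) (x : ℕ → ℕ → R) : ∀ i > N,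
    auxPoly n N x i = 0 := fun i hi => by rw [auxPoly, if_neg (by omega)]

lemma natDegree_auxPoly_le {R : Type*} [CommRing R] (n : ℕ) (x : ℕ → ℕ → R)
    (j : ℕ) :
    (auxPoly n N x j).natDegree ≤ n := by
  rw [auxPoly]
  split_ifs
  · refine natDegree_sum_le_of_forall_le _ _ fun i hi => (natDegree_monomial_le _).trans ?_
    simp at hi
    omega
  · simp

lemma coeff_auxPoly {R : Type*} [CommRing R] {n i j : ℕ} (x : ℕ → ℕ → R) (hi : i ≤ n)
    (hj : j ≤ N) : (auxPoly n N x j).coeff i = (n.factorial / i.factorial : ℕ) * x i j := by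
  rw [auxPoly, if_pos hj, finsetSum_coeff, Finset.sum_eq_single_of_mem i (by simp; omega)]
  · rw [coeff_monomial_same]
  · intro l _ hl
    rw [coeff_monomial_of_ne _ hl.symm]

lemma map_auxPoly {R S : Type*} [CommRing R] [CommRing S] (φ : R →+* S) (n : ℕ) (x : ℕ → ℕ → R)
    (j : ℕ) :
    (auxPoly n N x j).map φ = auxPoly n N (fun i j => φ (x i j)) j := by
  rw [auxPoly, auxPoly]
  split_ifs
  · simp [Polynomial.map_sum]
  · simp

lemma houseSum_auxPoly_le [NumberField K] {n : ℕ} {x : ℕ → ℕ → K} {M : ℝ}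
    (hx : ∀ i j, house (x i j) ≤ M) (j : ℕ) :
    houseSum (auxPoly n N x j) ≤ (n + 1) * (n.factorial * M) := by
  have hM : 0 ≤ M := (house_nonneg _).trans (hx 0 0)
  rw [auxPoly]
  split_ifs
  · refine (houseSum_sum_le _ _).trans ((Finset.sum_le_card_nsmul _ _ (n.factorial * M)
      fun i _ => ?_).trans_eq (by simp))
    rw [houseSum_monomial, house_nat_mul]
    gcongr
    · exact house_nonneg _
    · exact Nat.div_le_self _ _
    · exact hx _ _
  · rw [houseSum_zero]
    positivity

lemma hasSum_auxCoeff {s : ℕ → K} {φ : K →+* ℂ} {f : ℂ → ℂ}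
    (hs : ∀ z, HasSum (fun n => φ (s n) / n.factorial * z ^ n) (f z)) (n : ℕ) (x : ℕ → ℕ → K)
    (z : ℂ) :
    HasSum (fun m => (n.factorial * φ (auxCoeff s n N x m)) / m.factorial * z ^ m)
      (evalAlong N (fun j => (auxPoly n N x j).map φ) f z) := by
  have key : ∀ i ∈ Finset.range (n + 1), ∀ j, HasSum (fun m => n.factorial * (φ (x i j) *
      (m.choose i * φ (expPow s j (m - i)))) / m.factorial * z ^ m)
      ((n.factorial / i.factorial : ℕ) * φ (x i j) * z ^ i * f z ^ j) := by
    intro i hi j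
    have hin : i ≤ n := by simp at hi; omega
    rw [← (add_left_injective i).hasSum_iff]
    · convert! (hasSum_expPow hs j z).mul_left ((n.factorial / i.factorial : ℕ) * φ (x i j) * z ^ i)
        using 2 with l
      simp only [Function.comp_apply, Nat.add_sub_cancel]
      rw [Nat.add_choose, Nat.cast_div (Nat.factorial_mul_factorial_dvd_factorial_add l i)
        (by exact_mod_cast (Nat.mul_pos l.factorial_pos i.factorial_pos).ne'),
        Nat.cast_div (Nat.factorial_dvd_factorial hin) (by exact_mod_cast i.factorial_ne_zero)]
      have h0 : ∀ m : ℕ, (m.factorial : ℂ) ≠ 0 := fun m => by exact_mod_cast m.factorial_ne_zero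
      have := h0 i
      have := h0 l
      have := h0 (l + i)
      push_cast
      field_simp
      ring
    · intro m hm
      have : m < i := by
        by_contra h
        exact hm ⟨m - i, by simp; omega⟩
      simp [Nat.choose_eq_zero_of_lt this]
  convert! hasSum_sum fun i hi => hasSum_sum fun j (_ : j ∈ Finset.range (N + 1)) =>
    key i hi j using 1
  · funext m
    simp only [auxCoeff, map_sum, map_mul, map_natCast, Finset.mul_sum, Finset.sum_div,
      Finset.sum_mul]
  · rw [evalAlong, Finset.sum_comm]
    refine Finset.sum_congr rfl fun j hj => ?_
    rw [auxPoly, if_pos (by simp at hj; omega), Polynomial.map_sum, eval_finsetSum, Finset.sum_mul]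
    refine Finset.sum_congr rfl fun i _ => ?_
    simp

end AuxiliaryFunction

section Siegel

open NumberField

variable {K : Type*} [Field K] [NumberField K]

variable (K) in
/-- Siegel's lemma over a number field, with an unspecified constant. -/
lemma exists_siegel_constant : ∃ c : ℝ, 1 ≤ c ∧ ∀ {α β : Type} [Fintype α] [Fintype β]
    (M : Matrix α β (𝓞 K)) (A : ℝ), M ≠ 0 → 0 < Fintype.card α →
    Fintype.card α < Fintype.card β → (∀ k l, house (M k l : K) ≤ A) →
    ∃ x : β → 𝓞 K, x ≠ 0 ∧ M.mulVec x = 0 ∧ ∀ l, house (x l : K) ≤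
      c * (c * Fintype.card β * A) ^
        ((Fintype.card α : ℝ) / (Fintype.card β - Fintype.card α)) := by
  classical
  obtain ⟨c, hc⟩ : ∃ c : ℝ, ∀ {α β : Type} [Fintype α] [Fintype β]
      (M : Matrix α β (𝓞 K)) (A : ℝ), M ≠ 0 → 0 < Fintype.card α →
      Fintype.card α < Fintype.card β → (∀ k l, house (M k l : K) ≤ A) →
      ∃ x : β → 𝓞 K, x ≠ 0 ∧ M.mulVec x = 0 ∧ ∀ l, house (x l : K) ≤
        c * (c * Fintype.card β * A) ^
          ((Fintype.card α : ℝ) / (Fintype.card β - Fintype.card α)) :=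
    ⟨_, fun M A hM hα hαβ hA =>
      house.exists_ne_zero_int_vec_house_le K M hM hα hαβ rfl hA rfl⟩
  refine ⟨max 1 |c|, le_max_left _ _, fun {α β} _ _ M A hM hα hαβ hA => ?_⟩
  obtain ⟨x, hx, hMx, hxb⟩ := hc M A hM hα hαβ hA
  refine ⟨x, hx, hMx, fun l => (hxb l).trans ?_⟩
  have : Nonempty α := Fintype.card_pos_iff.mp hα
  have hA0 : 0 ≤ A := (house_nonneg _).trans (hA (Classical.arbitrary _) l)
  have hexp : (0 : ℝ) ≤ (Fintype.card α : ℝ) / (Fintype.card β - Fintype.card α) :=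
    div_nonneg (Nat.cast_nonneg _) (sub_nonneg.mpr (Nat.cast_le.mpr hαβ.le))
  set t : ℝ := (Fintype.card α : ℝ) / (Fintype.card β - Fintype.card α)
  calc _ ≤ |c * (c * Fintype.card β * A) ^ t| := le_abs_self _
    _ = |c| * |(c * Fintype.card β * A) ^ t| := abs_mul _ _
    _ ≤ |c| * |c * Fintype.card β * A| ^ t := by
        gcongr
        exact Real.abs_rpow_le_abs_rpow _ _
    _ ≤ _ := by
        rw [abs_mul, abs_mul, abs_of_nonneg hA0, Nat.abs_cast]
        gcongr
        · exact le_max_right _ _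
        · exact le_max_right _ _

/-- The auxiliary polynomials: there are small `x i j` for which the auxiliary function vanishes to
a high order at the origin. -/
lemma exists_auxCoeff_eq_zero {s : ℕ → K} {r D : ℝ} {d : ℕ → ℕ} (hr : 1 ≤ r)
    (hs : ∀ n, house (s n) ≤ r ^ (n + 1)) (hd : ∀ n, d n ≠ 0 ∧ (d n : ℝ) ≤ D ^ (n + 1))
    (hds : ∀ n, ∀ m ≤ n, IsIntegral ℤ ((d n : K) * s m)) {N : ℕ} (hN : 0 < N) :
    ∃ R : ℝ, 1 ≤ R ∧ ∀ n : ℕ, ∃ x : ℕ → ℕ → 𝓞 K, (∃ i ≤ n, ∃ j ≤ N, x i j ≠ 0) ∧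
      (∀ i j, house (x i j : K) ≤ R ^ (n + 1)) ∧
      ∀ m < N * (n + 1), auxCoeff s n N (fun i j => (x i j : K)) m = 0 := by
  have hD : 1 ≤ D := by
    have := (hd 0).2
    rw [zero_add, pow_one] at this
    exact le_trans (by exact_mod_cast Nat.one_le_iff_ne_zero.mpr (hd 0).1) this
  obtain ⟨c, hc, hsiegel⟩ := exists_siegel_constant K
  have hN1 : (1 : ℝ) ≤ N := by exact_mod_cast hN
  have hNr : 1 ≤ N * r := one_le_mul_of_one_le_of_one_le hN1 hr
  set A : ℝ := D ^ ((N + 1) * N) * (2 ^ N * (r ^ N * (N * r) ^ N)) with hA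
  have hA1 : 1 ≤ A := by
    refine one_le_mul_of_one_le_of_one_le (one_le_pow₀ hD) (one_le_mul_of_one_le_of_one_le
      (one_le_pow₀ one_le_two) (one_le_mul_of_one_le_of_one_le (one_le_pow₀ hr) (one_le_pow₀ hNr)))
  have hR1 : 1 ≤ c * (c * (2 * (N + 1)) * A) ^ N := by
    refine one_le_mul_of_one_le_of_one_le hc (one_le_pow₀ (one_le_mul_of_one_le_of_one_le
      (one_le_mul_of_one_le_of_one_le hc ?_) hA1))
    linarith
  refine ⟨c * (c * (2 * (N + 1)) * A) ^ N, hR1, fun n => ?_⟩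
  set T := N * (n + 1) with hT
  have hinteg : ∀ m i j : ℕ, m ≤ T → j ≤ N →
      IsIntegral ℤ ((d T : K) ^ N * (m.choose i * expPow s j (m - i))) := by
    intro m i j hm hj
    have : (d T : K) ^ N * (m.choose i * expPow s j (m - i)) =
        (d T : K) ^ (N - j) * (m.choose i * ((d T : K) ^ j * expPow s j (m - i))) := by
      rw [← Nat.sub_add_cancel hj, pow_add]
      simp only [Nat.add_sub_cancel]
      ring
    rw [this]
    exact ((isIntegral_natCast _).pow _).mul ((isIntegral_natCast _).mul
      (isIntegral_expPow (hds T) j _ (by omega)))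
  let M : Matrix (Fin T) (Fin (n + 1) × Fin (N + 1)) (𝓞 K) := fun m l =>
    ⟨_, hinteg m l.1 l.2 m.2.le (by omega)⟩
  have hMval : ∀ m l, (M m l : K) =
    (d T : K) ^ N * ((m : ℕ).choose l.1 * expPow s l.2 (m - l.1)) := fun _ _ => rfl
  have hTpos : 0 < T := by positivity
  have hM0 : M ≠ 0 := by
    intro h
    have h1 := hMval ⟨0, hTpos⟩ (0, 0)
    rw [h] at h1
    simp [expPow] at h1
    exact pow_ne_zero N (Nat.cast_ne_zero.mpr (hd T).1) h1.symm
  have hMA : ∀ m l, house (M m l : K) ≤ A ^ (n + 1) := by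
    intro m l
    rw [hMval]
    have h1 : house ((d T : K) ^ N) ≤ D ^ ((N + 1) * N * (n + 1)) := by
      rw [← Nat.cast_pow, house_natCast, Nat.cast_pow]
      calc (d T : ℝ) ^ N ≤ (D ^ (T + 1)) ^ N := pow_le_pow_left₀ (by positivity) (hd T).2 _
        _ = D ^ ((T + 1) * N) := by rw [pow_mul]
        _ ≤ _ := pow_le_pow_right₀ hD (by rw [hT]; nlinarith [Nat.zero_le n, Nat.zero_le N])
    have h2 : ((m : ℕ).choose l.1 : ℝ) ≤ 2 ^ T := by
      calc _ ≤ (2 : ℝ) ^ (m : ℕ) := by exact_mod_cast Nat.choose_le_two_pow _ _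
        _ ≤ _ := pow_le_pow_right₀ one_le_two m.2.le
    have h3 : house (expPow s l.2 (m - l.1)) ≤ r ^ (N * (n + 1)) * (N * r) ^ T := by
      refine (house_expPow_le hs _ _).trans ?_
      have hl : (l.2 : ℕ) ≤ N := by omega
      refine mul_le_mul (pow_le_pow_right₀ hr (by nlinarith)) ?_ (by positivity) (by positivity)
      calc ((l.2 : ℕ) * r) ^ ((m : ℕ) - l.1) ≤ (N * r) ^ ((m : ℕ) - l.1) := by gcongr
        _ ≤ _ := pow_le_pow_right₀ hNr (by omega)
    calc _ ≤ D ^ ((N + 1) * N * (n + 1)) * (2 ^ T * (r ^ (N * (n + 1)) * (N * r) ^ T)) := by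
          refine (house_mul_le _ _).trans (mul_le_mul h1 ?_ (house_nonneg _) (by positivity))
          rw [house_nat_mul]
          exact mul_le_mul h2 h3 (house_nonneg _) (by positivity)
      _ = A ^ (n + 1) := by rw [hA, hT]; simp only [mul_pow, ← pow_mul]
  obtain ⟨x, hx0, hMx, hxb⟩ := hsiegel M _ hM0 (by simpa using hTpos) (by
    simp only [Fintype.card_fin, Fintype.card_prod, hT]
    nlinarith) hMA
  let y : ℕ → ℕ → 𝓞 K := fun i j => if h : i < n + 1 ∧ j < N + 1 then x (⟨i, h.1⟩, ⟨j, h.2⟩) else 0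
  have hy : ∀ l : Fin (n + 1) × Fin (N + 1), y l.1 l.2 = x l := fun l => by
    exact dif_pos ⟨l.1.2, l.2.2⟩
  have hbound : ∀ l, house (x l : K) ≤ (c * (c * (2 * (N + 1)) * A) ^ N) ^ (n + 1) := by
    intro l
    refine (hxb l).trans ?_
    have hexp : (Fintype.card (Fin T) : ℝ) /
        (Fintype.card (Fin (n + 1) × Fin (N + 1)) - Fintype.card (Fin T)) = N := by
      simp only [Fintype.card_fin, Fintype.card_prod, hT]
      push_cast
      rw [div_eq_iff (by nlinarith)]
      ring
    rw [hexp, Real.rpow_natCast, Fintype.card_prod, Fintype.card_fin, Fintype.card_fin]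
    have hn : ((n + 1 : ℕ) : ℝ) ≤ 2 ^ (n + 1) := by
      exact_mod_cast Nat.lt_two_pow_self.le
    have h1 : c ≤ c ^ (n + 1) := le_self_pow₀ hc (by omega)
    have h2 : ((N + 1 : ℕ) : ℝ) ≤ (N + 1) ^ (n + 1) := by
      push_cast
      exact le_self_pow₀ (by linarith) (by omega)
    push_cast at hn h2 ⊢
    calc _ ≤ c ^ (n + 1) * (c ^ (n + 1) * (2 ^ (n + 1) * (N + 1) ^ (n + 1)) * A ^ (n + 1)) ^ N := by
          gcongr
      _ = _ := by simp only [mul_pow, ← pow_mul]; ring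
  refine ⟨y, ?_, fun i j => ?_, fun m hm => ?_⟩
  · obtain ⟨l, hl⟩ := Function.ne_iff.mp hx0
    exact ⟨l.1, by omega, l.2, by omega, by rw [hy]; exact hl⟩
  · by_cases h : i < n + 1 ∧ j < N + 1
    · simp only [y, dif_pos h]
      exact hbound _
    · simp only [y, dif_neg h]
      change house (algebraMap (𝓞 K) K 0) ≤ _
      rw [map_zero, house_zero]
      exact pow_nonneg (zero_le_one.trans hR1) _
  · have h1 := congrArg (algebraMap (𝓞 K) K) (congrFun hMx ⟨m, hm⟩)
    have hdT : (d T : K) ^ N ≠ 0 := pow_ne_zero _ (Nat.cast_ne_zero.mpr (hd T).1)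
    refine (mul_eq_zero.mp (?_ : (d T : K) ^ N * _ = 0)).resolve_left hdT
    rw [Pi.zero_apply, map_zero] at h1
    rw [← h1, auxCoeff, Matrix.mulVec, dotProduct, map_sum, Fintype.sum_prod_type, Finset.mul_sum,
      Finset.sum_range]
    refine Finset.sum_congr rfl fun i _ => ?_
    rw [Finset.mul_sum, Finset.sum_range]
    refine Finset.sum_congr rfl fun j _ => ?_
    rw [map_mul]
    refine Eq.trans ?_ (congrArg₂ (· * ·) (hMval ⟨m, hm⟩ (i, j)).symm
      (congrArg (algebraMap (𝓞 K) K) (hy (i, j))))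
    simp only
    ring

end Siegel

section Estimates

open NumberField

variable {K : Type*} [Field K] [NumberField K]

lemma house_auxCoeff_le {s : ℕ → K} {r : ℝ} (hr : 1 ≤ r) (hs : ∀ n, house (s n) ≤ r ^ (n + 1))
    {n N : ℕ} {x : ℕ → ℕ → K} {M : ℝ} (hx : ∀ i j, house (x i j) ≤ M) (m : ℕ) :
    house (auxCoeff s n N x m) ≤
      (n + 1) * ((N + 1) * (M * (r ^ N * (2 * ((N + 1) * r)) ^ m))) := by
  have hM : 0 ≤ M := (house_nonneg _).trans (hx 0 0)
  have hNr : 1 ≤ (N + 1) * r := one_le_mul_of_one_le_of_one_le (by simp) hr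
  rw [auxCoeff]
  refine (house_sum_le_sum_house _ _).trans ((Finset.sum_le_card_nsmul _ _
    ((N + 1) * (M * (r ^ N * (2 * ((N + 1) * r)) ^ m))) fun i _ => ?_).trans_eq (by simp))
  refine (house_sum_le_sum_house _ _).trans ((Finset.sum_le_card_nsmul _ _
    (M * (r ^ N * (2 * ((N + 1) * r)) ^ m)) fun j hj => ?_).trans_eq (by simp))
  have hj : j ≤ N := by simp at hj; omega
  refine (house_mul_le _ _).trans (mul_le_mul (hx _ _) ?_ (house_nonneg _) hM)
  rw [house_nat_mul]
  calc _ ≤ (2 : ℝ) ^ m * (r ^ j * (j * r) ^ (m - i)) := by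
        gcongr
        · exact house_nonneg _
        · exact_mod_cast Nat.choose_le_two_pow _ _
        · exact house_expPow_le hs _ _
    _ ≤ (2 : ℝ) ^ m * (r ^ N * ((N + 1) * r) ^ m) := by
        refine mul_le_mul_of_nonneg_left (mul_le_mul (pow_le_pow_right₀ hr hj) ?_ (by positivity)
          (by positivity)) (by positivity)
        calc (j * r) ^ (m - i) ≤ ((N + 1) * r) ^ (m - i) := by
              have : (j : ℝ) ≤ N := by exact_mod_cast hj
              gcongr
              linarith
          _ ≤ _ := pow_le_pow_right₀ hNr (by omega)
    _ = _ := by rw [mul_pow 2]; ring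

lemma natCast_add_one_le_two_pow (n : ℕ) : (n + 1 : ℝ) ≤ 2 ^ (n + 1) := by
  exact_mod_cast (Nat.lt_two_pow_self (n := n + 1)).le

/-- Upper bound for the derivatives of the auxiliary function. -/
lemma exists_norm_iteratedDeriv_le {s : ℕ → K} {φ : K →+* ℂ} {f : ℂ → ℂ} {r R : ℝ} (hr : 1 ≤ r)
    (hR : 1 ≤ R) (hs : ∀ z, HasSum (fun n => φ (s n) / n.factorial * z ^ n) (f z))
    (hsr : ∀ n, house (s n) ≤ r ^ (n + 1)) (N : ℕ) (z₀ : ℂ) :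
    ∃ C : ℝ, 1 ≤ C ∧ ∀ n (x : ℕ → ℕ → K), (∀ i j, house (x i j) ≤ R ^ (n + 1)) →
      (∀ m < N * (n + 1), auxCoeff s n N x m = 0) → ∀ k,
      ‖iteratedDeriv k (evalAlong N (fun j => (auxPoly n N x j).map φ) f) z₀‖ ≤
        C ^ (n + 1) * n.factorial * k.factorial / (N * (n + 1)).factorial := by
  have hf : Differentiable ℂ f := differentiable_of_forall_hasSum hs
  set S : ℝ := 2 * ((N + 1) * r) * (‖z₀‖ + 1) with hS
  have hN1 : (1 : ℝ) ≤ N + 1 := by simp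
  have hS1 : 1 ≤ S := one_le_mul_of_one_le_of_one_le (one_le_mul_of_one_le_of_one_le one_le_two
    (one_le_mul_of_one_le_of_one_le hN1 hr)) (by simp)
  have hE : 1 ≤ Real.exp S := Real.one_le_exp (by linarith)
  refine ⟨2 * ((N + 1) * (R * (r ^ N * (S ^ N * Real.exp S)))), ?_, fun n x hx hx0 k => ?_⟩
  · refine one_le_mul_of_one_le_of_one_le one_le_two (one_le_mul_of_one_le_of_one_le hN1
      (one_le_mul_of_one_le_of_one_le hR (one_le_mul_of_one_le_of_one_le (one_le_pow₀ hr)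
      (one_le_mul_of_one_le_of_one_le (one_le_pow₀ hS1) hE))))
  set F := evalAlong N (fun j => (auxPoly n N x j).map φ) f
  set M : ℝ := n.factorial * ((n + 1) * ((N + 1) * (R ^ (n + 1) * r ^ N))) with hM
  have hF : ∀ z ∈ Metric.sphere z₀ 1, ‖F z‖ ≤
      M * S ^ (N * (n + 1)) * Real.exp S / (N * (n + 1)).factorial := by
    intro z hz
    have hz : ‖z‖ ≤ ‖z₀‖ + 1 := by
      have : ‖z - z₀‖ = 1 := by simpa [dist_eq_norm] using hz
      calc ‖z‖ = ‖z₀ + (z - z₀)‖ := by ring_nf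
        _ ≤ _ := (norm_add_le _ _).trans_eq (by rw [this])
    refine norm_le_of_forall_hasSum (hasSum_auxCoeff hs n x z) (fun m hm => ?_) (fun m => ?_)
      (by linarith) (by positivity)
    · rw [hx0 m hm, map_zero, mul_zero]
    · rw [norm_mul, Complex.norm_natCast]
      calc _ ≤ n.factorial * ((n + 1) * ((N + 1) * (R ^ (n + 1) *
            (r ^ N * (2 * ((N + 1) * r)) ^ m)))) * (‖z₀‖ + 1) ^ m := by
            gcongr
            exact (norm_embedding_le_house _ φ).trans (house_auxCoeff_le hr hsr hx m)
        _ = _ := by rw [hM, hS, mul_pow _ (‖z₀‖ + 1)]; ring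
  have hd : Differentiable ℂ F := differentiable_evalAlong hf _
  have h := Complex.norm_iteratedDeriv_le_of_forall_mem_sphere_norm_le k one_pos
    hd.diffContOnCl hF
  rw [one_pow, div_one] at h
  refine h.trans ?_
  have hexp : Real.exp S ≤ Real.exp S ^ (n + 1) := le_self_pow₀ hE (by omega)
  have hrN : r ^ N ≤ (r ^ N) ^ (n + 1) := le_self_pow₀ (one_le_pow₀ hr) (by omega)
  have hNn : (N + 1 : ℝ) ≤ (N + 1) ^ (n + 1) := le_self_pow₀ hN1 (by omega)
  have h2 := natCast_add_one_le_two_pow n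
  rw [← mul_div_assoc]
  refine div_le_div_of_nonneg_right ?_ (Nat.cast_nonneg _)
  calc _ ≤ k.factorial * (n.factorial * (2 ^ (n + 1) * ((N + 1) ^ (n + 1) *
        (R ^ (n + 1) * (r ^ N) ^ (n + 1)))) * S ^ (N * (n + 1)) * Real.exp S ^ (n + 1)) := by
        rw [hM]
        gcongr
    _ = _ := by simp only [mul_pow, ← pow_mul]; ring

lemma natCast_add_one_pow_le (n : ℕ) : (n + 1 : ℝ) ^ n ≤ Real.exp 1 ^ (n + 1) * n.factorial := by
  have := Real.pow_div_factorial_le_exp (n + 1 : ℝ) (by positivity) n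
  rw [div_le_iff₀ (by positivity)] at this
  rwa [← Real.exp_nat_mul, mul_one, Nat.cast_succ]

/-- Upper bound for the conjugates of the values of the iterated derivatives of the auxiliary
polynomials. -/
lemma exists_house_sum_le {a b c : K[X]} {e : ℕ} (ha : a.natDegree ≤ e) (hb : b.natDegree ≤ e)
    (hc : c.natDegree ≤ e) {R : ℝ} (hR : 1 ≤ R) (N : ℕ) (x₀ y₀ : K) :
    ∃ C : ℝ, 1 ≤ C ∧ ∀ n (x : ℕ → ℕ → K), (∀ i j, house (x i j) ≤ R ^ (n + 1)) → ∀ k ≤ 2 * n,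
      house (∑ i ∈ Finset.range (N + 1),
        ((odeDerivation a b c)^[k] (auxPoly n N x) i).eval x₀ * y₀ ^ i) ≤
        C ^ (n + 1) * (n.factorial : ℝ) ^ 3 := by
  obtain ⟨L, hL1, hLa, hLb, hLc⟩ : ∃ L : ℝ, 1 ≤ L ∧ houseSum a ≤ L ∧ houseSum b ≤ L ∧
      houseSum c ≤ L :=
    ⟨max 1 (max (houseSum a) (max (houseSum b) (houseSum c))), by simp⟩
  obtain ⟨A, hA1, hAx, hAy⟩ : ∃ A : ℝ, 1 ≤ A ∧ house x₀ ≤ A ∧ house y₀ ≤ A :=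
    ⟨max 1 (max (house x₀) (house y₀)), by simp⟩
  set L' : ℝ := L * (1 + 2 * e + 2 * (N + 1)) with hL'
  have hL'1 : 1 ≤ L' := one_le_mul_of_one_le_of_one_le hL1
    (by nlinarith [Nat.cast_nonneg (α := ℝ) N, Nat.cast_nonneg (α := ℝ) e])
  have hN1 : (1 : ℝ) ≤ N + 1 := by simp
  have hexp1 : 1 ≤ Real.exp 1 := Real.one_le_exp zero_le_one
  refine ⟨(N + 1) * ((L' ^ 2 * Real.exp 1 ^ 2 * (2 * R)) * A ^ (1 + 2 * e) * A ^ N), ?_,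
    fun n x hx k hk => ?_⟩
  · refine one_le_mul_of_one_le_of_one_le hN1 (one_le_mul_of_one_le_of_one_le
      (one_le_mul_of_one_le_of_one_le (one_le_mul_of_one_le_of_one_le
      (one_le_mul_of_one_le_of_one_le (one_le_pow₀ hL'1) (one_le_pow₀ hexp1))
      (one_le_mul_of_one_le_of_one_le one_le_two hR)) (one_le_pow₀ hA1)) (one_le_pow₀ hA1))
  have hkn : (k : ℝ) ≤ 2 * n := by exact_mod_cast hk
  set M : ℝ := (n + 1) * (n.factorial * R ^ (n + 1)) with hM
  have hbound : ∀ i, houseSum ((odeDerivation a b c)^[k] (auxPoly n N x) i) ≤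
      (L' * (n + 1)) ^ k * M := by
    intro i
    refine houseSum_odeDerivation_iterate_le ha hb hc hLa hLb hLc (auxPoly_eq_zero n x)
      (natDegree_auxPoly_le n x) (houseSum_auxPoly_le hx) k i ?_
    rw [hL', mul_assoc]
    gcongr
    have he : (0 : ℝ) ≤ e := by positivity
    have hn : (0 : ℝ) ≤ n := by positivity
    have hN : (0 : ℝ) ≤ N := by positivity
    nlinarith [mul_le_mul_of_nonneg_right hkn he, mul_nonneg hn hN, mul_nonneg hn he]
  have hbound' : (L' * (n + 1)) ^ k * M ≤
      (L' ^ 2 * Real.exp 1 ^ 2 * (2 * R)) ^ (n + 1) * (n.factorial : ℝ) ^ 3 := by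
    calc _ ≤ (L' * (n + 1)) ^ (2 * n) * M := by
          gcongr
          exact one_le_mul_of_one_le_of_one_le hL'1 (by simp)
      _ = (L' ^ 2) ^ n * ((n + 1 : ℝ) ^ n) ^ 2 * M := by
          rw [mul_pow, pow_mul, pow_mul']
      _ ≤ (L' ^ 2) ^ (n + 1) * (Real.exp 1 ^ (n + 1) * n.factorial) ^ 2 *
          (2 ^ (n + 1) * (n.factorial * R ^ (n + 1))) := by
          rw [hM]
          gcongr
          · exact one_le_pow₀ hL'1
          · omega
          · exact natCast_add_one_pow_le n
          · exact natCast_add_one_le_two_pow n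
      _ = _ := by simp only [mul_pow, ← pow_mul]; ring
  refine (house_sum_le_sum_house _ _).trans ((Finset.sum_le_card_nsmul _ _
    ((L' ^ 2 * Real.exp 1 ^ 2 * (2 * R)) ^ (n + 1) * (n.factorial : ℝ) ^ 3 *
      A ^ (n + k * e) * A ^ N) fun i hi => ?_).trans ?_)
  · have hi : i ≤ N := by simp at hi; omega
    refine (house_mul_le _ _).trans (mul_le_mul ?_ ?_ (house_nonneg _) (by positivity))
    · refine (house_eval_le (natDegree_odeDerivation_iterate_le ha hb hc (natDegree_auxPoly_le n x)
        k i) hA1 hAx).trans ?_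
      gcongr
      exact (hbound i).trans hbound'
    · calc house (y₀ ^ i) ≤ house y₀ ^ i := house_pow_le _ _
        _ ≤ A ^ i := pow_le_pow_left₀ (house_nonneg _) hAy _
        _ ≤ A ^ N := pow_le_pow_right₀ hA1 hi
  · rw [nsmul_eq_mul, Finset.card_range, Nat.cast_succ]
    have h1 : A ^ (n + k * e) ≤ (A ^ (1 + 2 * e)) ^ (n + 1) := by
      rw [← pow_mul]
      refine pow_le_pow_right₀ hA1 ?_
      nlinarith [Nat.mul_le_mul_right e hk]
    have h2 : A ^ N ≤ (A ^ N) ^ (n + 1) := le_self_pow₀ (one_le_pow₀ hA1) (by omega)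
    have h3 : (N + 1 : ℝ) ≤ (N + 1) ^ (n + 1) := le_self_pow₀ hN1 (by omega)
    calc _ ≤ (N + 1 : ℝ) ^ (n + 1) * ((L' ^ 2 * Real.exp 1 ^ 2 * (2 * R)) ^ (n + 1) *
          (n.factorial : ℝ) ^ 3 * (A ^ (1 + 2 * e)) ^ (n + 1) * (A ^ N) ^ (n + 1)) := by gcongr
      _ = _ := by simp only [mul_pow]; ring

end Estimates

section Transcendence

open NumberField

/-- An algebraic number has a positive integral multiple which is an algebraic integer. -/
lemma exists_natCast_mul_isIntegral {L : Type*} [Field L] [CharZero L] {x : L}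
    (hx : IsAlgebraic ℚ x) : ∃ m : ℕ, m ≠ 0 ∧ IsIntegral ℤ ((m : L) * x) := by
  obtain ⟨y, hy, hyx⟩ := ((IsFractionRing.isAlgebraic_iff ℤ ℚ L).mpr hx).exists_integral_multiple
  refine ⟨y.natAbs, Int.natAbs_ne_zero.mpr hy, ?_⟩
  rw [zsmul_eq_mul] at hyx
  rcases Int.natAbs_eq y with h | h
  · rw [h] at hyx
    simpa using hyx
  · rw [h] at hyx
    simpa using hyx.neg

lemma factorial_two_mul_le (n : ℕ) : (2 * n).factorial ≤ 4 ^ n * n.factorial ^ 2 := by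
  rw [two_mul, ← Nat.add_choose_mul_factorial_mul_factorial, mul_assoc, ← sq]
  refine Nat.mul_le_mul_right _ ?_
  rw [← two_mul, ← Nat.centralBinom_eq_two_mul_choose]
  exact Nat.centralBinom_le_four_pow n

lemma pow_factorial_le (N n : ℕ) : n.factorial ^ N ≤ (N * (n + 1)).factorial := by
  induction N with
  | zero => simp
  | succ N ih =>
    calc n.factorial ^ (N + 1) ≤ (N * (n + 1)).factorial * (n + 1).factorial :=
          Nat.mul_le_mul ih (Nat.factorial_le (by omega))
      _ ≤ _ := by
          rw [Nat.succ_mul]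
          exact Nat.le_of_dvd (Nat.factorial_pos _)
            (Nat.factorial_mul_factorial_dvd_factorial_add _ _)

lemma exists_iteratedDeriv_ne_zero {g : ℂ → ℂ} (hg : Differentiable ℂ g) (h0 : g ≠ 0) (z : ℂ) :
    ∃ k : ℕ, (k : ℕ∞) ≤ analyticOrderAt g z ∧ (∀ i < k, iteratedDeriv i g z = 0) ∧
      iteratedDeriv k g z ≠ 0 := by
  obtain ⟨k, hk⟩ := ENat.ne_top_iff_exists.mp (analyticOrderAt_ne_top_of_ne_zero hg h0 z)
  have h := natCast_le_analyticOrderAt_iff_iteratedDeriv_eq_zero (n := k) (hg.analyticAt z)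
  refine ⟨k, hk.le, h.mp hk.le, fun hne => ?_⟩
  have := (natCast_le_analyticOrderAt_iff_iteratedDeriv_eq_zero (n := k + 1) (hg.analyticAt z)).mpr
    fun i hi => by
      rcases Nat.lt_succ_iff_lt_or_eq.mp hi with hi | rfl
      exacts [h.mp hk.le i hi, hne]
  rw [← hk] at this
  have : k + 1 ≤ k := by exact_mod_cast this
  omega

variable {K : Type*} [Field K]

lemma map_sum_eval_mul_pow (φ : K →+* ℂ) {f : ℂ → ℂ} {x₀ y₀ : K} (h : φ y₀ = f (φ x₀)) (N : ℕ)
    (q : ℕ → K[X]) : φ (∑ i ∈ Finset.range (N + 1), (q i).eval x₀ * y₀ ^ i) =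
      evalAlong N (fun i => (q i).map φ) f (φ x₀) := by
  simp [evalAlong, ← h, eval_map, eval₂_at_apply]

variable [NumberField K]

/-- The arithmetic part of the Siegel–Shidlovskii method for a first-order equation. -/
theorem not_isAlgebraic_value {φ : K →+* ℂ} {s : ℕ → K} {f : ℂ → ℂ} {r D : ℝ} {d : ℕ → ℕ}
    (hs : ∀ z, HasSum (fun n => φ (s n) / n.factorial * z ^ n) (f z)) (hr : 1 ≤ r)
    (hsr : ∀ n, house (s n) ≤ r ^ (n + 1)) (hd : ∀ n, d n ≠ 0 ∧ (d n : ℝ) ≤ D ^ (n + 1))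
    (hds : ∀ n, ∀ m ≤ n, IsIntegral ℤ ((d n : K) * s m)) (htr : ¬ IsAlgebraicFunc f)
    {a b c : (𝓞 K)[X]}
    (heq : ∀ z, ((a.map (algebraMap (𝓞 K) K)).map φ).eval z * deriv f z =
      ((b.map (algebraMap (𝓞 K) K)).map φ).eval z * f z +
        ((c.map (algebraMap (𝓞 K) K)).map φ).eval z)
    {x₀ : K} (hx₀ : x₀ ≠ 0) (hax : (a.map (algebraMap (𝓞 K) K)).eval x₀ ≠ 0) (y₀ : K) :
    φ y₀ ≠ f (φ x₀) := by
  intro hy₀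
  have hf : Differentiable ℂ f := differentiable_of_forall_hasSum hs
  set ι := algebraMap (𝓞 K) K
  set h := Module.finrank ℚ K with hh
  have hh0 : 0 < h := Module.finrank_pos
  set N := 3 * h + 1 with hN
  obtain ⟨e, hae, hbe, hce⟩ : ∃ e, a.natDegree ≤ e ∧ b.natDegree ≤ e ∧ c.natDegree ≤ e :=
    ⟨max a.natDegree (max b.natDegree c.natDegree), by simp⟩
  obtain ⟨m₁, hm₁, hm₁x⟩ := exists_natCast_mul_isIntegral
    (Algebra.IsAlgebraic.isAlgebraic (R := ℚ) x₀)
  obtain ⟨m₂, hm₂, hm₂y⟩ := exists_natCast_mul_isIntegral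
    (Algebra.IsAlgebraic.isAlgebraic (R := ℚ) y₀)
  obtain ⟨R, hR, hx⟩ := exists_auxCoeff_eq_zero hr hsr hd hds (N := N) (by omega)
  choose x hxne hxR hx0 using hx
  obtain ⟨B, hB⟩ := exists_zero_estimate hf htr (fun h0 => hax (by
    rw [(Polynomial.map_eq_zero φ).mp h0, eval_zero])) heq
    (z₀ := 0) (z₁ := φ x₀) ((map_ne_zero φ).mpr hx₀).symm N
  obtain ⟨C₁, hC₁, hup⟩ := exists_norm_iteratedDeriv_le hr hR hs hsr N (φ x₀)
  obtain ⟨C₂, hC₂, hhouse⟩ := exists_house_sum_le ((natDegree_map_le (f := ι)).trans hae)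
    ((natDegree_map_le (f := ι)).trans hbe) ((natDegree_map_le (f := ι)).trans hce) hR N x₀ y₀
  obtain ⟨L, hL1, hL⟩ : ∃ L : ℝ, 1 ≤ L ∧ ‖φ ((a.map ι).eval x₀)‖ ≤ L :=
    ⟨max 1 _, le_max_left _ _, le_max_right _ _⟩
  set E : ℝ := (m₁ : ℝ) ^ (1 + 2 * e) * m₂ ^ N with hE
  have hm₁1 : (1 : ℝ) ≤ m₁ := by exact_mod_cast Nat.one_le_iff_ne_zero.mpr hm₁
  have hm₂1 : (1 : ℝ) ≤ m₂ := by exact_mod_cast Nat.one_le_iff_ne_zero.mpr hm₂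
  have hE1 : 1 ≤ E := one_le_mul_of_one_le_of_one_le (one_le_pow₀ hm₁1) (one_le_pow₀ hm₂1)
  have main : ∀ n ≥ B, (n.factorial : ℝ) ≤
      (E * (L ^ 2 * (C₁ * 4)) * (E * C₂) ^ (h - 1)) ^ (n + 1) := by
    intro n hn
    set q : ℕ → K[X] := auxPoly n N (fun i j => ι (x n i j)) with hq
    have hqx : q = fun j => (auxPoly n N (x n) j).map ι := by
      funext j
      rw [map_auxPoly]
    set F := evalAlong N (fun j => (q j).map φ) f with hF
    have hqN : ∀ i > N, (q i).map φ = 0 := fun i hi => by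
      rw [hq, auxPoly_eq_zero n _ i hi, Polynomial.map_zero]
    have hq0 : (fun j => (q j).map φ) ≠ 0 := by
      obtain ⟨i, hi, j, hj, hij⟩ := hxne n
      intro h0
      have h1 := congrArg (fun p => coeff p i) (congrFun h0 j)
      simp only [hq, coeff_map, coeff_auxPoly _ hi hj, Pi.zero_apply, coeff_zero] at h1
      rw [map_eq_zero, mul_eq_zero, Nat.cast_eq_zero] at h1
      rcases h1 with h1 | h1
      · exact (Nat.div_pos (Nat.factorial_le hi) i.factorial_pos).ne' h1
      · exact hij (by simpa [ι] using h1)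
    have hFd : Differentiable ℂ F := differentiable_evalAlong hf _
    obtain ⟨k, hkle, hk0, hk1⟩ := exists_iteratedDeriv_ne_zero hFd
      (evalAlong_ne_zero htr hq0 hqN) (φ x₀)
    have hord : ((N * (n + 1) : ℕ) : ℕ∞) ≤ analyticOrderAt F 0 :=
      le_analyticOrderAt_zero_of_forall_hasSum (hasSum_auxCoeff hs n _) fun m hm => by
        rw [hx0 n m hm, map_zero, mul_zero, zero_div]
    have hk : k ≤ 2 * n := by
      have := hB n _ hq0 hqN (fun i => natDegree_map_le.trans (natDegree_auxPoly_le _ _ _)) _ _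
        hord hkle
      have h2 : N * (n + 1) = N * n + N := by ring
      have h3 : (N + 1) * n = N * n + n := by ring
      omega
    set ξ : K := ∑ i ∈ Finset.range (N + 1),
      ((odeDerivation (a.map ι) (b.map ι) (c.map ι))^[k] q i).eval x₀ * y₀ ^ i with hξ
    have hφξ : φ ξ = φ ((a.map ι).eval x₀) ^ k * iteratedDeriv k F (φ x₀) := by
      rw [hξ, map_sum_eval_mul_pow φ hy₀, ← odeDerivation_iterate_map,
        evalAlong_iterate_eq hf heq k hqN hk0, eval_map, eval₂_at_apply]
    have hξ0 : ξ ≠ 0 := fun h0 => by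
      rw [h0, map_zero, eq_comm] at hφξ
      refine mul_ne_zero (pow_ne_zero _ ?_) hk1 hφξ
      simpa using hax
    set M : ℕ := m₁ ^ (n + k * e) * m₂ ^ N with hM
    have hME : (M : ℝ) ≤ E ^ (n + 1) := by
      rw [hM, hE, mul_pow, ← pow_mul, ← pow_mul]
      push_cast
      exact mul_le_mul (pow_le_pow_right₀ hm₁1 (by nlinarith [Nat.mul_le_mul_right e hk]))
        (pow_le_pow_right₀ hm₂1 (by nlinarith)) (by positivity) (by positivity)
    have hinteg : IsIntegral ℤ ((M : K) * ξ) := by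
      rw [hξ, hqx, odeDerivation_iterate_map, Finset.mul_sum]
      refine IsIntegral.sum _ fun i hi => ?_
      have hi : i ≤ N := by simp at hi; omega
      have h1 := isIntegral_natCast_pow_mul_eval (natDegree_odeDerivation_iterate_le hae hbe hce
        (natDegree_auxPoly_le (N := N) n (x n)) k i) hm₁x
      have h2 := ((isIntegral_natCast (R := ℤ) (B := K) m₂).pow (N - i)).mul (hm₂y.pow i)
      have h3 : (m₂ : K) ^ N = m₂ ^ (N - i) * m₂ ^ i := by rw [← pow_add, Nat.sub_add_cancel hi]
      convert! h1.mul h2 using 1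
      rw [hM, Nat.cast_mul, Nat.cast_pow, Nat.cast_pow, h3]
      ring
    have hM0 : (M : K) ≠ 0 := by
      rw [hM]
      exact_mod_cast mul_ne_zero (pow_ne_zero _ hm₁) (pow_ne_zero _ hm₂)
    have hnorm := one_le_norm_mul_house_pow hinteg (mul_ne_zero hM0 hξ0) φ
    have hn0 : (0 : ℝ) < n.factorial := by positivity
    have hkf : (k.factorial : ℝ) ≤ 4 ^ (n + 1) * (n.factorial : ℝ) ^ 2 := by
      calc (k.factorial : ℝ) ≤ (2 * n).factorial := by exact_mod_cast Nat.factorial_le hk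
        _ ≤ 4 ^ n * (n.factorial : ℝ) ^ 2 := by exact_mod_cast factorial_two_mul_le n
        _ ≤ _ := by
          gcongr
          · norm_num
          · omega
    have hTf : (n.factorial : ℝ) ^ N ≤ (N * (n + 1)).factorial := by
      exact_mod_cast pow_factorial_le N n
    have hup1 : ‖φ (M * ξ)‖ ≤
        (E * (L ^ 2 * (C₁ * 4))) ^ (n + 1) * (n.factorial : ℝ) ^ 3 / (n.factorial : ℝ) ^ N := by
      rw [map_mul, map_natCast, norm_mul, Complex.norm_natCast, hφξ, norm_mul, norm_pow]
      calc _ ≤ E ^ (n + 1) * ((L ^ 2) ^ (n + 1) * (C₁ ^ (n + 1) * n.factorial *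
            (4 ^ (n + 1) * (n.factorial : ℝ) ^ 2) / (n.factorial : ℝ) ^ N)) := by
            refine mul_le_mul hME (mul_le_mul ?_ ?_ (norm_nonneg _) (by positivity))
              (by positivity) (by positivity)
            · calc _ ≤ L ^ k := pow_le_pow_left₀ (norm_nonneg _) hL _
                _ ≤ L ^ (2 * (n + 1)) := pow_le_pow_right₀ hL1 (by omega)
                _ = _ := by rw [pow_mul]
            · refine (hup n _ (hxR n) (hx0 n) k).trans ?_
              gcongr
        _ = _ := by simp only [mul_pow]; ring
    have hup2 : house (M * ξ) ≤ (E * C₂) ^ (n + 1) * (n.factorial : ℝ) ^ 3 := by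
      rw [house_nat_mul]
      calc _ ≤ E ^ (n + 1) * (C₂ ^ (n + 1) * (n.factorial : ℝ) ^ 3) := by
            refine mul_le_mul hME ?_ (house_nonneg _) (by positivity)
            exact hhouse n _ (hxR n) k hk
        _ = _ := by rw [mul_pow]; ring
    have hfin : (1 : ℝ) ≤ (E * (L ^ 2 * (C₁ * 4)) * (E * C₂) ^ (h - 1)) ^ (n + 1) *
        ((n.factorial : ℝ) ^ 3) ^ h / (n.factorial : ℝ) ^ N := by
      refine hnorm.trans ((mul_le_mul hup1 (pow_le_pow_left₀ (house_nonneg _) hup2 _)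
        (pow_nonneg (house_nonneg _) _) (by positivity)).trans_eq ?_)
      obtain ⟨g, hg⟩ : ∃ g, h = g + 1 := ⟨h - 1, by omega⟩
      rw [← hh, hg, Nat.add_sub_cancel]
      simp only [mul_pow, ← pow_mul]
      ring
    rw [le_div_iff₀ (by positivity), one_mul, hN, pow_succ, pow_mul, mul_comm] at hfin
    exact le_of_mul_le_mul_right hfin (by positivity)
  set G : ℝ := E * (L ^ 2 * (C₁ * 4)) * (E * C₂) ^ (h - 1)
  have hlim := (FloorSemiring.tendsto_pow_div_factorial_atTop G).const_mul G
  rw [mul_zero] at hlim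
  obtain ⟨n, hn, hnB⟩ := ((hlim.eventually_lt_const one_pos).and
    (Filter.eventually_ge_atTop B)).exists
  rw [← mul_div_assoc, div_lt_one (by positivity), ← pow_succ'] at hn
  exact (main n hnB).not_gt hn

end Transcendence

section Recurrence

lemma hasSum_polynomial_eval (p : ℂ[X]) (z : ℂ) :
    HasSum (fun n => p.coeff n * z ^ n) (p.eval z) := by
  rw [eval_eq_sum_range]
  refine hasSum_sum_of_ne_finset_zero fun n hn => ?_
  rw [coeff_eq_zero_of_natDegree_lt (by simpa using hn), zero_mul]

lemma hasSum_polynomial_eval_mul {u : ℕ → ℂ} {g : ℂ → ℂ}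
    (h : ∀ z, HasSum (fun n => u n * z ^ n) (g z)) (p : ℂ[X]) (z : ℂ) :
    HasSum (fun n => ((p : PowerSeries ℂ) * PowerSeries.mk u).coeff n * z ^ n)
      (p.eval z * g z) := by
  have hp := hasSum_polynomial_eval p z
  have h1 := summable_norm_sum_mul_antidiagonal_of_summable_norm hp.summable.norm
    (h z).summable.norm
  have h2 := tsum_mul_tsum_eq_tsum_sum_antidiagonal_of_summable_norm hp.summable.norm
    (h z).summable.norm
  rw [hp.tsum_eq, (h z).tsum_eq] at h2
  rw [h2]
  convert! h1.of_norm.hasSum using 2 with n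
  rw [PowerSeries.coeff_mul, Finset.sum_mul]
  refine Finset.sum_congr rfl fun x hx => ?_
  rw [← Finset.HasAntidiagonal.mem_antidiagonal.mp hx, Polynomial.coeff_coe, PowerSeries.coeff_mk]
  ring

lemma hasSum_mul_deriv {u : ℕ → ℂ} {g : ℂ → ℂ}
    (h : ∀ z, HasSum (fun n => u n * z ^ n) (g z)) (z : ℂ) :
    HasSum (fun n => n * u n * z ^ n) (z * deriv g z) := by
  have hd : Differentiable ℂ (deriv g) := (differentiable_of_forall_hasSum h).deriv
  have h1 := (Complex.hasSum_taylorSeries_of_entire hd 0 z).mul_left z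
  rw [← hasSum_nat_add_iff' 1]
  simp only [Finset.sum_range_one, Nat.cast_zero, zero_mul, sub_zero]
  convert! h1 using 2 with n
  rw [← iteratedDeriv_succ', iteratedDeriv_zero_of_forall_hasSum h, Nat.factorial_succ]
  have : (n.factorial : ℂ) ≠ 0 := by exact_mod_cast n.factorial_ne_zero
  simp only [smul_eq_mul, sub_zero]
  push_cast
  field_simp
  ring

/-- Taylor coefficients of an entire function are determined by the function. -/
lemma coeff_unique_of_forall_hasSum {u v : ℕ → ℂ} {g : ℂ → ℂ}
    (hu : ∀ z, HasSum (fun n => u n * z ^ n) (g z))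
    (hv : ∀ z, HasSum (fun n => v n * z ^ n) (g z)) (n : ℕ) : u n = v n := by
  have h := (iteratedDeriv_zero_of_forall_hasSum hu n).symm.trans
    (iteratedDeriv_zero_of_forall_hasSum hv n)
  exact mul_left_cancel₀ (by exact_mod_cast n.factorial_ne_zero) h

lemma sum_antidiagonal_of_first_order {u : ℕ → ℂ} {f : ℂ → ℂ}
    (h : ∀ z, HasSum (fun n => u n * z ^ n) (f z)) {a b c : ℂ[X]}
    (heq : ∀ z, a.eval z * deriv f z = b.eval z * f z + c.eval z) (k : ℕ) :
    ∑ x ∈ Finset.HasAntidiagonal.antidiagonal k,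
      (a.coeff x.1 * x.2 - (X * b).coeff x.1) * u x.2 = (X * c).coeff k := by
  have h1 := hasSum_polynomial_eval_mul (hasSum_mul_deriv h) a
  have h2 : ∀ z, HasSum (fun n =>
      (((X * b : ℂ[X]) : PowerSeries ℂ) * PowerSeries.mk u).coeff n * z ^ n +
        (X * c).coeff n * z ^ n)
      (a.eval z * (z * deriv f z)) := by
    intro z
    convert! (hasSum_polynomial_eval_mul h (X * b) z).add (hasSum_polynomial_eval (X * c) z) using 1
    simp only [eval_mul, eval_X]
    linear_combination z * heq z
  have := coeff_unique_of_forall_hasSum h1 (fun z => by simpa only [← add_mul] using h2 z) k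
  rw [PowerSeries.coeff_mul, PowerSeries.coeff_mul, ← sub_eq_iff_eq_add',
    ← Finset.sum_sub_distrib] at this
  rw [← this]
  refine Finset.sum_congr rfl fun x _ => ?_
  simp only [Polynomial.coeff_coe, PowerSeries.coeff_mk]
  ring

lemma exists_forall_ge_mul_sub_ne_zero {F : Type*} [Field F] [CharZero F] {x y : F}
    (h : x ≠ 0 ∨ y ≠ 0) : ∃ J : ℕ, ∀ j ≥ J, x * j - y ≠ 0 := by
  by_cases hx : x = 0
  · exact ⟨0, fun j _ => by simpa [hx] using h⟩
  by_cases hj : ∃ j : ℕ, x * j - y = 0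
  · obtain ⟨j₀, hj₀⟩ := hj
    refine ⟨j₀ + 1, fun j hj h0 => ?_⟩
    have : x * ((j : F) - j₀) = 0 := by linear_combination h0 - hj₀
    rcases mul_eq_zero.mp this with h | h
    · exact hx h
    · have : j = j₀ := by exact_mod_cast sub_eq_zero.mp h
      omega
  · push Not at hj
    exact ⟨0, fun j _ => hj j⟩

/-- A sequence satisfying a recurrence of the shape produced by a first order differential
equation lives in any field containing the coefficients and enough initial terms. -/
lemma exists_forall_mem_of_recurrence {F : Type*} [Field F] [CharZero F] {u : ℕ → F}
    {A B C : F[X]} (hA : A ≠ 0)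
    (h : ∀ k, ∑ x ∈ Finset.HasAntidiagonal.antidiagonal k,
      (A.coeff x.1 * x.2 - B.coeff x.1) * u x.2 = C.coeff k) :
    ∃ J : ℕ, ∀ L : Subfield F, (∀ i, A.coeff i ∈ L) → (∀ i, B.coeff i ∈ L) →
      (∀ i, C.coeff i ∈ L) → (∀ j < J, u j ∈ L) → ∀ j, u j ∈ L := by
  classical
  have hex : ∃ i, A.coeff i ≠ 0 ∨ B.coeff i ≠ 0 :=
    ⟨A.natDegree, Or.inl (by simpa using hA)⟩
  set i₀ := Nat.find hex
  obtain ⟨J, hJ⟩ := exists_forall_ge_mul_sub_ne_zero (Nat.find_spec hex)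
  refine ⟨J, fun L hAL hBL hCL hu j => ?_⟩
  induction j using Nat.strong_induction_on with
  | _ n ih =>
    rcases lt_or_ge n J with hn | hn
    · exact hu n hn
    have hk := h (i₀ + n)
    rw [← Finset.add_sum_erase _ _ (a := (i₀, n)) (by simp)] at hk
    have hne := hJ n hn
    have hun : u n = (A.coeff i₀ * n - B.coeff i₀)⁻¹ * (C.coeff (i₀ + n) -
        ∑ x ∈ (Finset.HasAntidiagonal.antidiagonal (i₀ + n)).erase (i₀, n),
          (A.coeff x.1 * x.2 - B.coeff x.1) * u x.2) := by
      rw [eq_inv_mul_iff_mul_eq₀ hne, ← hk]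
      ring
    rw [hun]
    refine L.mul_mem (L.inv_mem (L.sub_mem (L.mul_mem (hAL _) (natCast_mem L n)) (hBL _)))
      (L.sub_mem (hCL _) (L.sum_mem fun x hx => ?_))
    obtain ⟨i, j⟩ := x
    simp only [Finset.mem_erase, Finset.HasAntidiagonal.mem_antidiagonal, ne_eq,
      Prod.mk.injEq, not_and] at hx
    rcases lt_or_ge i i₀ with hi | hi
    · have := Nat.find_min hex hi
      push Not at this
      simp [this]
    · have hi' : i ≠ i₀ := fun h => hx.1 h (by omega)
      exact L.mul_mem (L.sub_mem (L.mul_mem (hAL _) (natCast_mem L j)) (hBL _)) (ih j (by omega))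

end Recurrence

section Descent

open NumberField

lemma house_le_of_forall_embedding {L : IntermediateField ℚ ℂ} [NumberField L] {x : L} {q : Qbar}
    (h : (x : ℂ) = q) {M : ℝ} (hM : ∀ σ : Qbar →+* ℂ, ‖σ q‖ ≤ M) : house x ≤ M := by
  have : Algebra.IsAlgebraic ℚ Qbar := algebraicClosure.isAlgebraic ℚ ℂ
  have hmin : minpoly ℚ x = minpoly ℚ q := by
    rw [← minpoly.algebraMap_eq (algebraMap L ℂ).injective x,
      ← minpoly.algebraMap_eq (algebraMap Qbar ℂ).injective q]
    exact congrArg (minpoly ℚ) h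
  obtain ⟨σ, hσ⟩ : ∃ σ : L →+* ℂ, house x = ‖σ x‖ := by
    obtain ⟨σ, -, hσ⟩ := Finset.exists_mem_eq_sup' Finset.univ_nonempty fun σ : L →+* ℂ => ‖σ x‖₊
    exact ⟨σ, by rw [house_eq_sup', hσ, coe_nnnorm]⟩
  have hroot : σ x ∈ (minpoly ℚ q).rootSet ℂ := by
    rw [mem_rootSet, ← hmin]
    refine ⟨minpoly.ne_zero (Algebra.IsIntegral.isIntegral x), ?_⟩
    have := minpoly.aeval ℚ x
    have h2 := congrArg σ.toRatAlgHom this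
    rwa [← aeval_algHom_apply, map_zero] at h2
  rw [← Algebra.IsAlgebraic.range_eval_eq_rootSet_minpoly ℂ q] at hroot
  obtain ⟨ψ, hψ⟩ := hroot
  rw [hσ, ← hψ]
  exact hM (ψ : Qbar →+* ℂ)

/-- Finitely many polynomials over a number field have a common nonzero integral multiplier
making all their coefficients algebraic integers. -/
lemma exists_map_ringOfIntegers_eq_mul {K : Type*} [Field K] [NumberField K] (s : Finset K[X]) :
    ∃ y : K, y ≠ 0 ∧ ∀ p ∈ s, ∃ q : (𝓞 K)[X], q.map (algebraMap (𝓞 K) K) = C y * p := by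
  classical
  have : Algebra.IsAlgebraic ℤ K :=
    (IsFractionRing.comap_isAlgebraic_iff (A := ℤ) (K := ℚ)).mpr inferInstance
  obtain ⟨y, hy, hys⟩ := Algebra.IsAlgebraic.exists_integral_multiples ℤ
    (s.biUnion fun p => p.support.image p.coeff)
  refine ⟨y, by exact_mod_cast hy, fun p hp => ?_⟩
  rw [← mem_lifts, lifts_iff_coeff_lifts]
  intro n
  rw [coeff_C_mul]
  have hinteg : IsIntegral ℤ ((y : K) * p.coeff n) := by
    by_cases hn : p.coeff n = 0
    · rw [hn, mul_zero]
      exact isIntegral_zero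
    · rw [← zsmul_eq_mul]
      exact hys _ (Finset.mem_biUnion.mpr ⟨p, hp, Finset.mem_image_of_mem _ (by simpa using hn)⟩)
  exact ⟨⟨_, hinteg⟩, rfl⟩

lemma not_isAlgebraic_apply_of_eval_ne_zero {f : ℂ → ℂ} (hf : IsEFunction f)
    (htr : ¬ IsAlgebraicFunc f) {a b c : ℂ[X]} (halg : ∀ k, IsAlgebraic ℚ (a.coeff k))
    (hblg : ∀ k, IsAlgebraic ℚ (b.coeff k)) (hclg : ∀ k, IsAlgebraic ℚ (c.coeff k))
    (heq : ∀ z, a.eval z * deriv f z = b.eval z * f z + c.eval z)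
    {α : ℂ} (hα : IsAlgebraic ℚ α) (hα0 : α ≠ 0) (hax : a.eval α ≠ 0) :
    ¬ IsAlgebraic ℚ (f α) := by
  classical
  intro hfα
  obtain ⟨t, hsum, ⟨C₀, hC₀, hconj⟩, ⟨D, -, d, hd, hinteg⟩, -⟩ := hf
  have ha : a ≠ 0 := by
    rintro rfl
    simp at hax
  obtain ⟨J, hJ⟩ := exists_forall_mem_of_recurrence (u := fun n => (t n : ℂ) / n.factorial) ha
    (sum_antidiagonal_of_first_order hsum heq)
  let S : Set ℂ := {α, f α} ∪ (a.coeffs ∪ b.coeffs ∪ c.coeffs : Finset ℂ) ∪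
    (fun n => (t n : ℂ) / n.factorial) '' Set.Iio J
  have hSfin : S.Finite :=
    ((Set.toFinite _).union (Finset.finite_toSet _)).union ((Set.finite_Iio J).image _)
  have hcoeffs : ∀ p : ℂ[X], (∀ k, IsAlgebraic ℚ (p.coeff k)) → ∀ x ∈ p.coeffs,
      IsAlgebraic ℚ x := by
    intro p hp x hx
    obtain ⟨n, -, rfl⟩ := mem_coeffs_iff.mp hx
    exact hp n
  have hSalg : ∀ x ∈ S, IsIntegral ℚ x := by
    intro x hx
    refine IsAlgebraic.isIntegral ?_
    rcases hx with (hx | hx) | ⟨n, -, rfl⟩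
    · rcases hx with rfl | rfl
      exacts [hα, hfα]
    · simp only [Finset.coe_union, Set.mem_union, Finset.mem_coe] at hx
      rcases hx with (hx | hx) | hx
      exacts [hcoeffs a halg x hx, hcoeffs b hblg x hx, hcoeffs c hclg x hx]
    · exact mem_algebraicClosure_iff.mp (div_mem (t n).2 (natCast_mem Qbar _))
  let L := IntermediateField.adjoin ℚ S
  have : Finite S := hSfin
  have : FiniteDimensional ℚ L := IntermediateField.finiteDimensional_adjoin hSalg
  have : NumberField L := ⟨⟩
  have hSL : S ⊆ L := IntermediateField.subset_adjoin ℚ S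
  have hcoeffL : ∀ p : ℂ[X], p.coeffs ⊆ a.coeffs ∪ b.coeffs ∪ c.coeffs → ∀ n, p.coeff n ∈ L := by
    intro p hp n
    by_cases hn : p.coeff n = 0
    · rw [hn]
      exact zero_mem L
    · exact hSL (Or.inl (Or.inr (hp (coeff_mem_coeffs hn))))
  have haL := hcoeffL a fun x hx => by simp [hx]
  have hbL := hcoeffL b fun x hx => by simp [hx]
  have hcL := hcoeffL c fun x hx => by simp [hx]
  have hXL : ∀ p : ℂ[X], (∀ n, p.coeff n ∈ L) → ∀ n, (X * p).coeff n ∈ L := by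
    rintro p hp (_ | n)
    · rw [coeff_X_mul_zero]
      exact zero_mem L
    · rw [coeff_X_mul]
      exact hp n
  have huL : ∀ n, (t n : ℂ) / n.factorial ∈ L := hJ L.toSubfield haL (hXL b hbL) (hXL c hcL)
    fun j hj => hSL (Or.inr ⟨j, hj, rfl⟩)
  have htL : ∀ n, (t n : ℂ) ∈ L := by
    intro n
    have := mul_mem (huL n) (natCast_mem L n.factorial)
    rwa [div_mul_cancel₀ _ (by exact_mod_cast n.factorial_ne_zero)] at this
  have hlift : ∀ p : ℂ[X], (∀ n, p.coeff n ∈ L) → ∃ q : L[X], q.map (algebraMap L ℂ) = p := by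
    intro p hp
    rw [← mem_lifts, lifts_iff_coeff_lifts]
    exact fun n => ⟨⟨_, hp n⟩, rfl⟩
  have hαL : α ∈ L := hSL (by simp [S])
  have hfL : f α ∈ L := hSL (by simp [S])
  clear_value L S
  obtain ⟨a, rfl⟩ := hlift a haL
  obtain ⟨b, rfl⟩ := hlift b hbL
  obtain ⟨c, rfl⟩ := hlift c hcL
  obtain ⟨y, hy, hyp⟩ := exists_map_ringOfIntegers_eq_mul {a, b, c}
  obtain ⟨a', ha'⟩ := hyp a (by simp)
  obtain ⟨b', hb'⟩ := hyp b (by simp)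
  obtain ⟨c', hc'⟩ := hyp c (by simp)
  let x₀ : L := ⟨α, hαL⟩
  let y₀ : L := ⟨f α, hfL⟩
  refine not_isAlgebraic_value (φ := algebraMap L ℂ) (s := fun n => (⟨t n, htL n⟩ : L))
    (r := max 1 C₀) (x₀ := x₀) hsum (le_max_left _ _) (fun n => ?_) hd (fun n m hm => ?_) htr
    (a := a') (b := b') (c := c') (fun z => ?_) (fun h => hα0 (congrArg Subtype.val h)) ?_ y₀ rfl
  · exact house_le_of_forall_embedding (x := (⟨t n, htL n⟩ : L)) (q := t n) rfl fun σ =>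
      (hconj σ n).trans (pow_le_pow_left₀ hC₀.le (le_max_right _ _) _)
  · rw [← isIntegral_algebraMap_iff (algebraMap L ℂ).injective]
    simpa using hinteg n m hm
  · rw [ha', hb', hc']
    simp only [Polynomial.map_mul, map_C, eval_mul, eval_C]
    linear_combination algebraMap L ℂ y * heq z
  · rw [ha', eval_mul, eval_C]
    refine mul_ne_zero hy fun h => hax ?_
    have h2 := congrArg (algebraMap L ℂ) h
    rwa [← eval_map_apply, map_zero] at h2

lemma IsAlgebraic.polynomial_eval {F E : Type*} [Field F] [Field E] [Algebra F E] {p : E[X]}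
    (hp : ∀ k, IsAlgebraic F (p.coeff k)) {x : E} (hx : IsAlgebraic F x) :
    IsAlgebraic F (p.eval x) := by
  simp only [← mem_algebraicClosure_iff (F := F)] at *
  rw [eval_eq_sum_range]
  exact sum_mem fun k _ => mul_mem (hp k) (pow_mem hx k)

end Descent

/-- Dichotomy for transcendental E-functions satisfying a first-order (possibly
inhomogeneous) differential equation `a f' = b f + c` with `a, b, c ∈ ℚ̄[z]`, `a ≠ 0`,
and `a, b, c` without a common nonconstant factor: at a nonzero algebraic point `α`,
`f(α)` is algebraic iff `a(α) = 0`; in that case `f(α) = -c(α)/b(α)`, and in the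
homogeneous case `c ≡ 0` one has `f(α) = 0`. -/
theorem first_order_dichotomy (f : ℂ → ℂ)
    (hf : IsEFunction f) (htr : ¬ IsAlgebraicFunc f)
    (a b c : Polynomial ℂ)
    (halg : ∀ k, IsAlgebraic ℚ (a.coeff k))
    (hblg : ∀ k, IsAlgebraic ℚ (b.coeff k))
    (hclg : ∀ k, IsAlgebraic ℚ (c.coeff k))
    (ha : a ≠ 0)
    (hcop : ∀ q : Polynomial ℂ, q ∣ a → q ∣ b → q ∣ c → ¬ (0 < q.natDegree))
    (heq : ∀ z : ℂ, a.eval z * deriv f z = b.eval z * f z + c.eval z)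
    (α : ℂ) (hα : IsAlgebraic ℚ α) (hα0 : α ≠ 0) :
    (IsAlgebraic ℚ (f α) ↔ a.eval α = 0) ∧
    (a.eval α = 0 → f α = - c.eval α / b.eval α) ∧
    (c = 0 → a.eval α = 0 → f α = 0) := by
  have hval : a.eval α = 0 → f α = - c.eval α / b.eval α := by
    intro h0
    have h1 := heq α
    rw [h0, zero_mul] at h1
    have hb : b.eval α ≠ 0 := by
      intro hb
      have hc : c.eval α = 0 := by simpa [hb] using h1.symm
      exact hcop (X - C α) (dvd_iff_isRoot.mpr h0) (dvd_iff_isRoot.mpr hb)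
        (dvd_iff_isRoot.mpr hc) (by simp)
    rw [eq_div_iff hb]
    linear_combination -h1
  refine ⟨⟨fun hfα => ?_, fun h0 => ?_⟩, hval, fun hc h0 => ?_⟩
  · by_contra hax
    exact not_isAlgebraic_apply_of_eval_ne_zero hf htr halg hblg hclg heq hα hα0 hax hfα
  · rw [hval h0, div_eq_mul_inv]
    exact (IsAlgebraic.polynomial_eval hclg hα).neg.mul (IsAlgebraic.polynomial_eval hblg hα).inv
  · rw [hval h0, hc, eval_zero, neg_zero, zero_div]
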